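/- Let D, D' be domains in ℂ², both possibly unbounded, and f : D → D' a non-constant holomorphic mapping. Suppose M ⊂ ∂D is an open, smooth real analytic hypersurface of finite type, and let p ∈ M. Let U be a neighbourhood of p in ℂ² such that the cluster set of no point of U ∩ M intersects D'. Then there exists a possibly smaller neighbourhood V of p such that the restriction f : V ∩ D → D' has discrete fibres, i.e., for every z' ∈ D' the set f⁻¹(z') ∩ V ∩ D is discrete. -/

import Mathlib

open Complex Metric Filter Topology Set

noncomputable section

/-- We identify `ℂ²` with `ℂ × ℂ`. -/
abbrev C2 := ℂ × ℂ

/-- Coordinatewise complex conjugation on `ℂ²`. -/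
def conj2 (w : C2) : C2 := (starRingEnd ℂ w.1, starRingEnd ℂ w.2)

/-- A domain in `ℂ²`: an open connected set. -/
def IsDomain2 (D : Set C2) : Prop := IsOpen D ∧ IsConnected D

/-- `f` extends holomorphically across the boundary point `p` of `D`. -/
def ExtendsHoloAcross (f : C2 → C2) (D : Set C2) (p : C2) : Prop :=
  ∃ (V : Set C2) (g : C2 → C2), IsOpen V ∧ p ∈ V ∧ DifferentiableOn ℂ g V ∧
    Set.EqOn f g (V ∩ D)

/-- The cluster set of `S ⊆ ∂D` under `f : D → D'`: limits of `f (z n)` along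
sequences `z n ∈ D` converging to a point of `S`. -/
def clusterSet (f : C2 → C2) (D S : Set C2) : Set C2 :=
  {w | ∃ z : ℕ → C2, (∀ n, z n ∈ D) ∧ (∃ s ∈ S, Tendsto z atTop (nhds s)) ∧
    Tendsto (fun n => f (z n)) atTop (nhds w)}

/-- The cluster set of a single boundary point. -/
def clusterPtSet (f : C2 → C2) (D : Set C2) (p : C2) : Set C2 := clusterSet f D {p}

/-- The cluster set of a sequence of sets: points which are limits of
subsequences of points chosen in the sets. -/
def seqClusterSet {E : Type*} [TopologicalSpace E] (A : ℕ → Set E) : Set E :=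
  {z | ∃ (φ : ℕ → ℕ) (x : ℕ → E), StrictMono φ ∧ (∀ k, x k ∈ A (φ k)) ∧
    Tendsto x atTop (nhds z)}

/-- `r` is a real-analytic local defining function for `M` on `U`. -/
def IsLocalDefiningFn (M U : Set C2) (r : C2 → ℝ) : Prop :=
  AnalyticOnNhd ℝ r U ∧ (∀ z ∈ U, fderiv ℝ r z ≠ 0) ∧ M ∩ U = {z ∈ U | r z = 0}

/-- `M` is a smooth real analytic real hypersurface in `ℂ²`. -/
def IsRealAnalyticHypersurface (M : Set C2) : Prop :=
  ∀ p ∈ M, ∃ (U : Set C2) (r : C2 → ℝ), IsOpen U ∧ p ∈ U ∧ IsLocalDefiningFn M U r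

/-- `M` contains no germ of a positive dimensional complex analytic set:
every holomorphic disc contained in `M` is constant. -/
def ContainsNoComplexCurve (M : Set C2) : Prop :=
  ∀ (φ : ℂ → C2) (ε : ℝ), 0 < ε → DifferentiableOn ℂ φ (ball (0:ℂ) ε) →
    (∀ ζ ∈ ball (0:ℂ) ε, φ ζ ∈ M) → ∀ ζ ∈ ball (0:ℂ) ε, φ ζ = φ 0

/-- A smooth real analytic hypersurface of finite type (in the sense of D'Angelo). -/
def IsFiniteTypeHypersurface (M : Set C2) : Prop :=
  IsRealAnalyticHypersurface M ∧ ContainsNoComplexCurve M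

/-- `M` is an open piece of the boundary of `D`. -/
def IsOpenBoundaryPiece (M D : Set C2) : Prop :=
  M ⊆ frontier D ∧ ∃ O : Set C2, IsOpen O ∧ M = frontier D ∩ O

/-- `r` is a local defining function for `M = ∂D` on `U` with `D` on the side `r < 0`. -/
def IsDefiningFnFor (D M U : Set C2) (r : C2 → ℝ) : Prop :=
  IsLocalDefiningFn M U r ∧ D ∩ U = {z ∈ U | r z < 0}

/-- The Levi form of `r` at `p` in the direction `v`:
`∑ ∂²r/∂z_i∂z̄_j v_i v̄_j = (D²r(v,v) + D²r(iv,iv))/4`. -/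
def leviForm (r : C2 → ℝ) (p v : C2) : ℝ :=
  (iteratedFDeriv ℝ 2 r p ![v, v] + iteratedFDeriv ℝ 2 r p ![I • v, I • v]) / 4

/-- The complex tangent space at `p` of the level set of `r`. -/
def complexTangentAt (r : C2 → ℝ) (p : C2) : Set C2 :=
  {v | fderiv ℝ r p v = 0 ∧ fderiv ℝ r p (I • v) = 0}

/-- `p` is a strongly pseudoconvex boundary point of `D` on `M`. -/
def StronglyPseudoconvexAt (D M : Set C2) (p : C2) : Prop :=
  ∃ (U : Set C2) (r : C2 → ℝ), IsOpen U ∧ p ∈ U ∧ IsDefiningFnFor D M U r ∧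
    ∀ v : C2, v ≠ 0 → v ∈ complexTangentAt r p → 0 < leviForm r p v

/-- `p` is a strongly pseudoconcave boundary point of `D` on `M`. -/
def StronglyPseudoconcaveAt (D M : Set C2) (p : C2) : Prop :=
  ∃ (U : Set C2) (r : C2 → ℝ), IsOpen U ∧ p ∈ U ∧ IsDefiningFnFor D M U r ∧
    ∀ v : C2, v ≠ 0 → v ∈ complexTangentAt r p → leviForm r p v < 0

/-- `M` is pseudoconvex (with `D` on the pseudoconvex side) near `p`. -/
def PseudoconvexNear (D M : Set C2) (p : C2) : Prop :=
  ∃ (U : Set C2) (r : C2 → ℝ), IsOpen U ∧ p ∈ U ∧ IsDefiningFnFor D M U r ∧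
    ∀ z ∈ M ∩ U, ∀ v ∈ complexTangentAt r z, 0 ≤ leviForm r z v

/-- The Levi form of `M` degenerates at `p`. -/
def LeviDegenerateAt (D M : Set C2) (p : C2) : Prop :=
  ∃ (U : Set C2) (r : C2 → ℝ), IsOpen U ∧ p ∈ U ∧ IsDefiningFnFor D M U r ∧
    ∃ v : C2, v ≠ 0 ∧ v ∈ complexTangentAt r p ∧ leviForm r p v = 0

/-- `M_s⁺`: the strongly pseudoconvex points of `M`. -/
def strongPcvxPts (D M : Set C2) : Set C2 := {q ∈ M | StronglyPseudoconvexAt D M q}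

/-- `M_s⁻`: the strongly pseudoconcave points of `M`. -/
def strongPccvPts (D M : Set C2) : Set C2 := {q ∈ M | StronglyPseudoconcaveAt D M q}

/-- `M⁺`: the relative interior in `M` of the closure of the strongly
pseudoconvex points. -/
def Mplus (D M : Set C2) : Set C2 :=
  {q ∈ M | ∃ V : Set C2, IsOpen V ∧ q ∈ V ∧ M ∩ V ⊆ closure (strongPcvxPts D M)}

/-- `M⁻`: the relative interior in `M` of the closure of the strongly
pseudoconcave points. -/
def Mminus (D M : Set C2) : Set C2 :=
  {q ∈ M | ∃ V : Set C2, IsOpen V ∧ q ∈ V ∧ M ∩ V ⊆ closure (strongPccvPts D M)}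

/-- The border `M \ (M⁺ ∪ M⁻)` between the pseudoconvex and pseudoconcave points. -/
def borderSet (D M : Set C2) : Set C2 := M \ (Mplus D M ∪ Mminus D M)

/-- `S` is, near `p ∈ S`, a two dimensional (maximally) totally real real
analytic submanifold of `ℂ²`. -/
def IsTotallyRealSurfaceAt (S : Set C2) (p : C2) : Prop :=
  ∃ (U : Set C2) (ρ₁ ρ₂ : C2 → ℝ), IsOpen U ∧ p ∈ U ∧
    AnalyticOnNhd ℝ ρ₁ U ∧ AnalyticOnNhd ℝ ρ₂ U ∧
    S ∩ U = {z ∈ U | ρ₁ z = 0 ∧ ρ₂ z = 0} ∧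
    LinearIndependent ℝ ![fderiv ℝ ρ₁ p, fderiv ℝ ρ₂ p] ∧
    ∀ v : C2, v ≠ 0 → ¬(fderiv ℝ ρ₁ p v = 0 ∧ fderiv ℝ ρ₂ p v = 0 ∧
      fderiv ℝ ρ₁ p (I • v) = 0 ∧ fderiv ℝ ρ₂ p (I • v) = 0)

/-- `γ` is, near `p ∈ γ`, a smooth real analytic arc. -/
def IsRealAnalyticArcAt (γ : Set C2) (p : C2) : Prop :=
  ∃ (U : Set C2) (φ : ℝ → C2) (δ : ℝ), IsOpen U ∧ p ∈ U ∧ 0 < δ ∧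
    AnalyticOnNhd ℝ φ (Ioo (-δ) δ) ∧ (∀ t ∈ Ioo (-δ) δ, deriv φ t ≠ 0) ∧
    InjOn φ (Ioo (-δ) δ) ∧ γ ∩ U = φ '' (Ioo (-δ) δ) ∧ φ 0 = p

/-- `p` lies on the two dimensional maximally totally real stratum `Sstr = T₂⁺` of the
Levi-degenerate set of `M` lying inside the weakly pseudoconvex part `M⁺`. -/
def OnTotallyRealDegenerateStratumPlus (D M Sstr : Set C2) (p : C2) : Prop :=
  p ∈ Sstr ∧ Sstr ⊆ Mplus D M ∧
    (∀ q ∈ Sstr, LeviDegenerateAt D M q ∧ IsTotallyRealSurfaceAt Sstr q) ∧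
    ∃ V : Set C2, IsOpen V ∧ p ∈ V ∧
      {q ∈ M ∩ V | LeviDegenerateAt D M q} = Sstr ∩ V

/-- `p` lies on the two dimensional totally real stratum `Sstr = T₂` of the border
of `M` between the pseudoconvex and the pseudoconcave points. -/
def OnBorderTotallyRealStratum (D M Sstr : Set C2) (p : C2) : Prop :=
  p ∈ Sstr ∧ Sstr ⊆ borderSet D M ∧
    (∀ q ∈ Sstr, IsTotallyRealSurfaceAt Sstr q) ∧
    ∃ V : Set C2, IsOpen V ∧ p ∈ V ∧ borderSet D M ∩ V = Sstr ∩ V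

/-- A closed complex analytic subset `A` of an open set `Ω`: `A` is closed in `Ω`
and locally the common zero set of a family of holomorphic functions. -/
def IsClosedAnalyticIn {E : Type*} [NormedAddCommGroup E] [NormedSpace ℂ E]
    (Ω A : Set E) : Prop :=
  A ⊆ Ω ∧ (∀ x ∈ Ω, x ∈ closure A → x ∈ A) ∧
  ∀ a ∈ A, ∃ (V : Set E) (g : ℕ → E → ℂ), IsOpen V ∧ a ∈ V ∧ V ⊆ Ω ∧
    (∀ n, DifferentiableOn ℂ (g n) V) ∧ A ∩ V = {z ∈ V | ∀ n, g n z = 0}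

/-- The dimension of `A` at `a` is at least `k`: every neighbourhood of `a`
contains an embedded holomorphic `k`-ball lying in `A`. -/
def dimAtLeastAt {E : Type*} [NormedAddCommGroup E] [NormedSpace ℂ E]
    (k : ℕ) (A : Set E) (a : E) : Prop :=
  ∀ V : Set E, IsOpen V → a ∈ V → ∃ (φ : (Fin k → ℂ) → E) (ε : ℝ), 0 < ε ∧
    DifferentiableOn ℂ φ (ball (0 : Fin k → ℂ) ε) ∧ InjOn φ (ball 0 ε) ∧
    φ '' (ball 0 ε) ⊆ A ∩ V

/-- The dimension of `A` is at most `k`: `A` contains no embedded holomorphic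
`(k+1)`-ball. -/
def dimAtMost {E : Type*} [NormedAddCommGroup E] [NormedSpace ℂ E]
    (k : ℕ) (A : Set E) : Prop :=
  ¬ ∃ (φ : (Fin (k+1) → ℂ) → E) (ε : ℝ), 0 < ε ∧
    DifferentiableOn ℂ φ (ball (0 : Fin (k+1) → ℂ) ε) ∧ InjOn φ (ball 0 ε) ∧
    φ '' (ball 0 ε) ⊆ A

/-- A closed complex analytic subset of `Ω` of pure dimension `k`. -/
def IsPureDimAnalyticIn {E : Type*} [NormedAddCommGroup E] [NormedSpace ℂ E]
    (k : ℕ) (Ω A : Set E) : Prop :=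
  IsClosedAnalyticIn Ω A ∧ (∀ a ∈ A, dimAtLeastAt k A a) ∧ dimAtMost k A

/-- An irreducible closed complex analytic subset of `Ω`. -/
def AnalyticIrreducibleIn {E : Type*} [NormedAddCommGroup E] [NormedSpace ℂ E]
    (Ω A : Set E) : Prop :=
  IsClosedAnalyticIn Ω A ∧ ∀ B C : Set E, IsClosedAnalyticIn Ω B →
    IsClosedAnalyticIn Ω C → A = B ∪ C → A = B ∨ A = C

/-- `f` has discrete fibres on `S`. -/
def HasDiscreteFibresOn (f : C2 → C2) (S : Set C2) : Prop :=
  ∀ z ∈ S, ∃ W : Set C2, IsOpen W ∧ z ∈ W ∧ ∀ w ∈ W ∩ S, f w = f z → w = z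

/-- The positive side `{r > 0}` of `M` inside `U`. -/
def plusIn (r : C2 → ℝ) (U : Set C2) : Set C2 := {z ∈ U | 0 < r z}

/-- The negative side `{r < 0}` of `M` inside `U`. -/
def minusIn (r : C2 → ℝ) (U : Set C2) : Set C2 := {z ∈ U | r z < 0}

/-- `U` is a bidisc (an open polydisc) in `ℂ²`. -/
def IsBidisc (U : Set C2) : Prop :=
  ∃ (a : C2) (r₁ r₂ : ℝ), 0 < r₁ ∧ 0 < r₂ ∧ U = (ball a.1 r₁) ×ˢ (ball a.2 r₂)

/-- `A` is the graph over the `z₁`-axis in `U` of some function `h`. -/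
def IsGraphOverZ1 (A U : Set C2) : Prop :=
  ∃ h : ℂ → ℂ, A = {z ∈ U | z.2 = h z.1}

/-- The germ of `Q` at the point `x` is contained in the set `T`. -/
def germSubsetOf (Q : Set C2) (x : C2) (T : Set C2) : Prop :=
  ∃ N : Set C2, IsOpen N ∧ x ∈ N ∧ Q ∩ N ⊆ T

/-- The one-dimensional real analytic set `A` (e.g. `Q'_{w'} ∩ M'`) meets the
boundary of `U` transversally: at each common point, `A` is a smooth curve, the
boundary is a smooth hypersurface, and the tangent of the curve is not tangent
to the boundary. -/
def ArcMeetsBoundaryTransversally (A U : Set C2) : Prop :=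
  ∀ q ∈ A ∩ frontier U, ∃ (γ : ℝ → C2) (δ : ℝ) (ρ : C2 → ℝ) (W : Set C2),
    0 < δ ∧ IsOpen W ∧ q ∈ W ∧ γ 0 = q ∧ ContDiffOn ℝ 1 γ (Ioo (-δ) δ) ∧
    γ '' (Ioo (-δ) δ) = A ∩ W ∧ ContDiffOn ℝ 1 ρ W ∧
    frontier U ∩ W = {z ∈ W | ρ z = 0} ∧ fderiv ℝ ρ q (deriv γ 0) ≠ 0

/-- A standard pair of neighbourhoods `U₁ ⋐ U₂` for `M = ∂D`, together with a
real analytic defining function `r`, its complexification `R` (holomorphic in the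
first variable, antiholomorphic in the second, real on the diagonal), which
defines the Segre varieties, and the symmetric point map `sym`. -/
structure SegreSetup (D M : Set C2) where
  U1 : Set C2
  U2 : Set C2
  r : C2 → ℝ
  R : C2 → C2 → ℂ
  sym : C2 → C2
  open1 : IsOpen U1
  open2 : IsOpen U2
  closure1 : closure U1 ⊆ U2
  defining : IsDefiningFnFor D M U2 r
  holo_z : ∀ w ∈ U2, DifferentiableOn ℂ (fun z => R z w) U2
  holo_w : ∀ z ∈ U2, DifferentiableOn ℂ (fun w => R z (conj2 w)) (conj2 '' U2)
  diag : ∀ z ∈ U2, R z z = (r z : ℂ)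
  sym_mem : ∀ w ∈ U1, sym w ∈ U2 ∧ R (sym w) w = 0
  sym_side : ∀ w ∈ U1, (0 < r w → r (sym w) < 0) ∧ (r w < 0 → 0 < r (sym w)) ∧
    (r w = 0 → sym w = w)
  sym_line : ∀ w ∈ U1, ∃ ζ ∈ M ∩ U2, (∀ ξ ∈ M ∩ U2, dist w ζ ≤ dist w ξ) ∧
    ∃ c : ℂ, sym w = w + c • (w - ζ)

namespace SegreSetup

variable {D M : Set C2}

/-- The Segre variety `Q_w` associated to `w`. -/
def Q (S : SegreSetup D M) (w : C2) : Set C2 := {z ∈ S.U2 | S.R z w = 0}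

/-- `U₁⁺`, the part of `U₁` on the pseudoconvex side. -/
def U1plus (S : SegreSetup D M) : Set C2 := plusIn S.r S.U1

/-- `U₂⁻`. -/
def U2minus (S : SegreSetup D M) : Set C2 := minusIn S.r S.U2

end SegreSetup

/-- The analytic set `X_f ⊆ W⁺ × W'⁺`: pairs `(w, w')` such that `f(Q_w ∩ D)`
contains the germ of `Q'_{w'}` at the symmetric point `ˢw'`. -/
def XfSet {D M D' M' : Set C2} (f : C2 → C2)
    (S : SegreSetup D M) (S' : SegreSetup D' M') (W W' : Set C2) : Set (C2 × C2) :=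
  {ww : C2 × C2 | ww.1 ∈ W ∧ 0 < S.r ww.1 ∧ ww.2 ∈ W' ∧ 0 < S'.r ww.2 ∧
    germSubsetOf (S'.Q ww.2) (S'.sym ww.2) (f '' (S.Q ww.1 ∩ D))}

/-- The analytic set `X_j = {(w,w') ∈ V_j × W' : F(Q_w ∩ U_j) ⊆ Q'_{w'}}`,
where `F` is the local holomorphic extension of `f` near `p^j`. -/
def XjSet {D M D' M' : Set C2} (F : C2 → C2)
    (S : SegreSetup D M) (S' : SegreSetup D' M') (Vj Uj W' : Set C2) : Set (C2 × C2) :=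
  {ww : C2 × C2 | ww.1 ∈ Vj ∧ ww.2 ∈ W' ∧ F '' (S.Q ww.1 ∩ Uj) ⊆ S'.Q ww.2}

/-- The basic setting: a holomorphic map `f : D → D'` between domains in `ℂ²`,
with open boundary pieces `M ⊆ ∂D`, `M' ⊆ ∂D'` which are smooth real analytic
hypersurfaces of finite type. -/
structure MapSetting where
  D : Set C2
  D' : Set C2
  M : Set C2
  M' : Set C2
  f : C2 → C2
  hD : IsDomain2 D
  hD' : IsDomain2 D'
  holo : DifferentiableOn ℂ f D
  maps : MapsTo f D D'
  hM : IsOpenBoundaryPiece M D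
  hM' : IsOpenBoundaryPiece M' D'
  hMft : IsFiniteTypeHypersurface M
  hM'ft : IsFiniteTypeHypersurface M'


/-- The setting of case (i): `p ∈ M` strongly pseudoconvex, `p' ∈ cl_f(p)` lying on
a two dimensional totally real stratum `T'₂` of the border of `M'`; a sequence
`p^j → p` on `M` across which `f` extends holomorphically to bidiscs `U_j`, with
`f(p^j) = p'^j → p'`; neighbourhoods `V_j` of `Q_{p^j}`; and bidisc neighbourhoods
`Ũ' ⋐ U'` of `p'` satisfying the conditions (i), (ii), (iii) of Section 4.3. -/
structure CaseISetting extends MapSetting where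
  p : C2
  p' : C2
  S : SegreSetup D M
  S' : SegreSetup D' M'
  hpM : p ∈ M
  hpU1 : p ∈ S.U1
  hp'M' : p' ∈ M'
  hp'U1' : p' ∈ S'.U1
  hpsp : StronglyPseudoconvexAt D M p
  hcl : ∃ U : Set C2, IsOpen U ∧ p ∈ U ∧ clusterSet f D (U ∩ M) ∩ D' = ∅
  hp'cl : p' ∈ clusterPtSet f D p
  T2' : Set C2
  hT2' : OnBorderTotallyRealStratum D' M' T2' p'
  pj : ℕ → C2
  p'j : ℕ → C2
  Uj : ℕ → Set C2
  Fj : ℕ → C2 → C2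
  Vj : ℕ → Set C2
  Ut' : Set C2
  U' : Set C2
  hpjM : ∀ j, pj j ∈ M ∩ S.U1
  hpjlim : Tendsto pj atTop (nhds p)
  hUjbidisc : ∀ j, IsBidisc (Uj j)
  hpjUj : ∀ j, pj j ∈ Uj j
  hFjholo : ∀ j, DifferentiableOn ℂ (Fj j) (Uj j)
  hFjeq : ∀ j, Set.EqOn f (Fj j) (Uj j ∩ D)
  hFjpj : ∀ j, Fj j (pj j) = p'j j
  hp'jM' : ∀ j, p'j j ∈ M' ∩ S'.U1
  hp'jlim : Tendsto p'j atTop (nhds p')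
  hVjopen : ∀ j, IsOpen (Vj j)
  hVjsub : ∀ j, Vj j ⊆ S.U1
  hVjQ : ∀ j, S.Q (pj j) ⊆ Vj j
  hVjgraph : ∀ j, ∀ w ∈ Vj j, (S.Q w ∩ Uj j).Nonempty ∧ IsConnected (S.Q w ∩ Uj j) ∧
    IsGraphOverZ1 (S.Q w ∩ Uj j) (Uj j)
  hUt'bidisc : IsBidisc Ut'
  hU'bidisc : IsBidisc U'
  hUt'cpt : closure Ut' ⊆ U'
  hU'sub : U' ⊆ S'.U2
  hp'Ut' : p' ∈ Ut'
  hsym' : ∀ w' ∈ Ut', 0 < S'.r w' → S'.sym w' ∈ minusIn S'.r U'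
  hgraph' : ∀ w' ∈ Ut', IsGraphOverZ1 (S'.Q w' ∩ U') U'
  htrans' : ∀ w' ∈ Ut', ArcMeetsBoundaryTransversally (S'.Q w' ∩ M') U'

namespace CaseISetting

/-- `X_f ⊆ U₁⁺ × U₁'⁺` for the setting of case (i). -/
def Xf (st : CaseISetting) : Set (C2 × C2) := XfSet st.f st.S st.S' st.S.U1 st.S'.U1

/-- `X_f ⊆ U₁⁺ × Ũ'⁺`, the variant of `X_f` over the bidisc `Ũ'` in the target. -/
def XfUt (st : CaseISetting) : Set (C2 × C2) := XfSet st.f st.S st.S' st.S.U1 st.Ut'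

/-- `Y` is the irreducible two dimensional component of `X_j` which coincides with
the graph of (the holomorphic extension of) `f` near `(p^j, p'^j)`. -/
def IsGraphComponent (st : CaseISetting) (j : ℕ) (Y : Set (C2 × C2)) : Prop :=
  Y ⊆ XjSet (st.Fj j) st.S st.S' (st.Vj j) (st.Uj j) st.S'.U1 ∧
  AnalyticIrreducibleIn (st.Vj j ×ˢ st.S'.U1) Y ∧
  (∀ a ∈ Y, dimAtLeastAt 2 Y a) ∧ dimAtMost 2 Y ∧
  ∃ N : Set (C2 × C2), IsOpen N ∧ (st.pj j, st.p'j j) ∈ N ∧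
    Y ∩ N = {zz ∈ N | zz.1 ∈ st.Uj j ∧ st.Fj j zz.1 = zz.2}

/-- `C_j = X_j ∩ ((Q_{p^j} \ {p^j}) × Q'_{p'^j})`, where `X_j` has been replaced by
its irreducible component `Y` through the graph of `f`. -/
def CjOf (st : CaseISetting) (j : ℕ) (Y : Set (C2 × C2)) : Set (C2 × C2) :=
  Y ∩ ((st.S.Q (st.pj j) \ {st.pj j}) ×ˢ st.S'.Q (st.p'j j))

end CaseISetting

/-- The setting of case (ii) at a point `p ∈ T₂⁺`: `p` lies on a two dimensional
maximally totally real stratum `T2p` of the Levi-degenerate set inside `M⁺`, the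
cluster set of `p` is contained in the border `T' \ (M'⁺ ∪ M'⁻)` of `M'`, `U'` is
an open set compactly containing `cl_f(p)` with `U' ∩ M'` a closed smooth real
analytic hypersurface of finite type, the standard pair `U₁ ⊆ U₂` around `p` is
such that `(Q_p \ {p}) ∩ M ∩ U₂` consists of strongly pseudoconvex points,
`f(U₂⁻) ⋐ U'`, and for `w' ∈ ∂U' \ D'` the symmetric point `ˢw'` avoids `f(U₂⁻)`. -/
structure CaseIISetting extends MapSetting where
  p : C2
  S : SegreSetup D M
  S' : SegreSetup D' M'
  hpM : p ∈ M
  hpU1 : p ∈ S.U1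
  T2p : Set C2
  hstr : OnTotallyRealDegenerateStratumPlus D M T2p p
  hcl : ∃ U : Set C2, IsOpen U ∧ p ∈ U ∧ clusterSet f D (U ∩ M) ∩ D' = ∅
  hclp : clusterPtSet f D p ⊆ borderSet D' M'
  U' : Set C2
  hU'open : IsOpen U'
  hU'sub : U' ⊆ S'.U2
  hclpcpt : IsCompact (closure (clusterPtSet f D p)) ∧
    closure (clusterPtSet f D p) ⊆ U'
  hU'M'closed : ∀ x ∈ U', x ∈ closure (U' ∩ M') → x ∈ U' ∩ M'
  hU'M'ft : IsFiniteTypeHypersurface (U' ∩ M')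
  hQp : (S.Q p \ {p}) ∩ M ∩ S.U2 ⊆ strongPcvxPts D M
  hfU2cpt : IsCompact (closure (f '' S.U2minus)) ∧ closure (f '' S.U2minus) ⊆ U'
  hsymout : ∀ w' ∈ frontier U' \ D', S'.sym w' ∉ f '' S.U2minus

namespace CaseIISetting

/-- `X_f ⊆ U₁⁺ × U'⁺` for the setting of case (ii). -/
def Xf (st : CaseIISetting) : Set (C2 × C2) := XfSet st.f st.S st.S' st.S.U1 st.U'

/-- `𝓛 = ⋃_{w ∈ T₂⁺} Q_w`. -/
def LL (st : CaseIISetting) : Set C2 := ⋃ w ∈ st.T2p ∩ st.S.U1, st.S.Q w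

end CaseIISetting

theorem differentiableOn_circleIntegral_param (G : ℂ → ℂ → ℂ) (c : ℂ) (R δ M : ℝ) (hR : 0 ≤ R)
    (h1 : ∀ t ∈ ball (0 : ℂ) δ, ContinuousOn (fun s => G s t) (sphere c R))
    (h2 : ∀ s ∈ sphere c R, DifferentiableOn ℂ (G s) (ball 0 δ))
    (h3 : ∀ s ∈ sphere c R, ∀ t ∈ ball (0 : ℂ) δ, ‖G s t‖ ≤ M) :
    DifferentiableOn ℂ (fun t => ∮ s in C(c, R), G s t) (ball 0 δ) := by
  intro t₀ ht₀
  obtain ⟨e, he, hsub⟩ : ∃ e > 0, ball t₀ (e + e) ⊆ ball (0 : ℂ) δ := by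
    obtain ⟨e, he, h⟩ := Metric.isOpen_iff.1 isOpen_ball t₀ ht₀
    exact ⟨e / 2, by positivity, by rwa [add_halves]⟩
  have hmem : ∀ θ, circleMap c R θ ∈ sphere c R := fun θ => circleMap_mem_sphere c hR θ
  have hcont : ∀ t ∈ ball (0 : ℂ) δ,
      Continuous (fun θ : ℝ => deriv (circleMap c R) θ • G (circleMap c R θ) t) := by
    intro t ht
    have hg : Continuous (fun θ => G (circleMap c R θ) t) :=
      (h1 t ht).comp_continuous (continuous_circleMap c R) hmem
    have : Continuous (deriv (circleMap c R)) := by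
      have : deriv (circleMap c R) = fun θ => circleMap 0 R θ * I := by
        ext θ; exact deriv_circleMap c R θ
      rw [this]; fun_prop
    exact this.smul hg
  have hdiff : ∀ s ∈ sphere c R, ∀ t ∈ ball t₀ (e + e), HasDerivAt (G s) (deriv (G s) t) t := by
    intro s hs t ht
    exact ((h2 s hs).differentiableAt (isOpen_ball.mem_nhds (hsub ht))).hasDerivAt
  have key := intervalIntegral.hasDerivAt_integral_of_dominated_loc_of_deriv_le
    (𝕜 := ℂ) (μ := MeasureTheory.volume) (a := 0) (b := 2 * Real.pi)
    (F := fun t θ => deriv (circleMap c R) θ • G (circleMap c R θ) t)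
    (F' := fun t θ => deriv (circleMap c R) θ • deriv (G (circleMap c R θ)) t)
    (x₀ := t₀) (s := ball t₀ e) (bound := fun _ => R * (M / e)) (ball_mem_nhds t₀ he)
    ?_ ?_ ?_ ?_ ?_ ?_
  · exact key.2.differentiableAt.differentiableWithinAt
  · filter_upwards [isOpen_ball.mem_nhds ht₀] with t ht
    exact (hcont t ht).aestronglyMeasurable
  · exact (hcont t₀ ht₀).intervalIntegrable _ _
  · -- measurability of the derivative as a limit of difference quotients
    set u : ℕ → ℂ := fun n => ((e / (n + 2) : ℝ) : ℂ) with hu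
    have hu0 : ∀ n, u n ≠ 0 := by
      intro n
      simp only [hu, ne_eq, ofReal_eq_zero]
      positivity
    have hub : ∀ n, t₀ + u n ∈ ball (0 : ℂ) δ := by
      intro n
      apply hsub
      rw [mem_ball, dist_eq_norm, add_sub_cancel_left, hu]
      simp only [norm_real, Real.norm_eq_abs]
      rw [abs_of_pos (by positivity)]
      have : e / ((n : ℝ) + 2) ≤ e := div_le_self he.le (by linarith [(Nat.cast_nonneg n : (0:ℝ) ≤ n)])
      linarith
    have hulim : Tendsto u atTop (𝓝[≠] 0) := by
      rw [tendsto_nhdsWithin_iff]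
      refine ⟨?_, Eventually.of_forall hu0⟩
      have h : Tendsto (fun n : ℕ => e / ((n : ℝ) + 2)) atTop (𝓝 0) := by
        apply Tendsto.div_atTop tendsto_const_nhds
        exact tendsto_atTop_add_const_right _ _ tendsto_natCast_atTop_atTop
      have := (continuous_ofReal.tendsto 0).comp h
      rw [ofReal_zero] at this
      exact this
    refine aestronglyMeasurable_of_tendsto_ae (u := atTop)
      (f := fun (n : ℕ) θ => deriv (circleMap c R) θ • ((u n)⁻¹ • (G (circleMap c R θ) (t₀ + u n)
        - G (circleMap c R θ) t₀))) ?_ ?_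
    · intro n
      have := ((hcont _ (hub n)).sub (hcont _ ht₀)).const_smul ((u n)⁻¹)
      refine (this.congr ?_).aestronglyMeasurable
      intro θ
      simp only [smul_eq_mul, Pi.smul_apply, Pi.sub_apply]
      ring
    · refine Eventually.of_forall fun θ => ?_
      have := (hasDerivAt_iff_tendsto_slope_zero.1 (hdiff _ (hmem θ) t₀
        (mem_ball_self (by positivity)))).comp hulim
      exact this.const_smul _
  · refine Eventually.of_forall fun θ _ t ht => ?_
    rw [norm_smul]
    have hn : ‖deriv (circleMap c R) θ‖ = R := by
      rw [deriv_circleMap, norm_mul, norm_I, mul_one, norm_circleMap_zero, abs_of_nonneg hR]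
    rw [hn]
    refine mul_le_mul_of_nonneg_left ?_ hR
    have hcl : closedBall t ‖((e / 2 : ℝ) : ℂ)‖ ⊆ ball t₀ (e + e) := by
      intro x hx
      rw [mem_closedBall, norm_real, Real.norm_eq_abs, abs_of_pos (by positivity)] at hx
      rw [mem_ball] at ht ⊢
      linarith [dist_triangle x t t₀]
    have hsub2 : ball t e ⊆ ball t₀ (e + e) := by
      intro x hx
      rw [mem_ball] at hx ht ⊢
      linarith [dist_triangle x t t₀]
    have hM : ∀ r, 0 < r → r < e → ‖deriv (G (circleMap c R θ)) t‖ ≤ M / r := by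
      intro r hr hre
      apply Complex.norm_deriv_le_of_forall_mem_sphere_norm_le hr
      · apply DifferentiableOn.diffContOnCl
        refine (h2 _ (hmem θ)).mono ?_
        rw [closure_ball _ hr.ne']
        exact (closedBall_subset_ball hre).trans (hsub2.trans hsub)
      · intro z hz
        exact h3 _ (hmem θ) _ (hsub (hsub2 (sphere_subset_closedBall.trans
          (closedBall_subset_ball hre) hz)))
    have hlim : Tendsto (fun r => M / r) (𝓝[<] e) (𝓝 (M / e)) :=
      (tendsto_const_nhds.div (tendsto_id.mono_left nhdsWithin_le_nhds) he.ne')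
    refine ge_of_tendsto hlim ?_
    filter_upwards [Ioo_mem_nhdsLT he] with r hr
    exact hM r hr.1 hr.2
  · exact intervalIntegrable_const
  · refine Eventually.of_forall fun θ _ t ht => ?_
    exact (hdiff _ (hmem θ) t (ball_subset_ball (by linarith) ht)).const_mul _

theorem exists_eq_pow_mul_of_differentiableOn {U : Set ℂ} (hU : IsOpen U) {φ : ℂ → ℂ}
    (hφ : DifferentiableOn ℂ φ U) {a : ℂ} (ha : a ∈ U) (hne : ¬ ∀ᶠ z in 𝓝 a, φ z = 0) :
    ∃ (m : ℕ) (g : ℂ → ℂ), DifferentiableOn ℂ g U ∧ g a ≠ 0 ∧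
      ∀ s, φ s = (s - a) ^ m * g s := by
  obtain ⟨m, g₀, hg₀, hne0, heq⟩ :=
    ((hφ.analyticAt (hU.mem_nhds ha)).exists_eventuallyEq_pow_smul_nonzero_iff).2 hne
  have hA := heq.self_of_nhds
  refine ⟨m, fun s => if s = a then g₀ a else φ s / (s - a) ^ m, ?_, by simpa using hne0, ?_⟩
  · intro s hs
    by_cases h : s = a
    · subst h
      refine (hg₀.differentiableAt.congr_of_eventuallyEq ?_).differentiableWithinAt
      filter_upwards [heq] with z hz
      by_cases hzs : z = s
      · simp [hzs]
      · have : (z - s) ^ m ≠ 0 := pow_ne_zero _ (sub_ne_zero.2 hzs)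
        rw [if_neg hzs, hz, smul_eq_mul]
        field_simp
    · have hpow : (s - a) ^ m ≠ 0 := pow_ne_zero _ (sub_ne_zero.2 h)
      have : DifferentiableAt ℂ (fun s => φ s / (s - a) ^ m) s :=
        (hφ.differentiableAt (hU.mem_nhds hs)).div (by fun_prop) hpow
      refine (this.congr_of_eventuallyEq ?_).differentiableWithinAt
      filter_upwards [isOpen_ne.mem_nhds h] with z hz
      rw [if_neg hz]
  · intro s
    by_cases h : s = a
    · subst h
      simpa using hA
    · have hpow : (s - a) ^ m ≠ 0 := pow_ne_zero _ (sub_ne_zero.2 h)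
      simp only [if_neg h]
      field_simp

theorem finite_zeros_closedBall {φ : ℂ → ℂ} {R R' : ℝ} (hR : 0 < R) (hRR : R < R')
    (hφ : DifferentiableOn ℂ φ (ball 0 R')) (hne : ∀ s ∈ sphere (0 : ℂ) R, φ s ≠ 0) :
    {s | s ∈ closedBall (0 : ℂ) R ∧ φ s = 0}.Finite := by
  by_contra hinf
  obtain ⟨x, hx, hacc⟩ := Set.Infinite.exists_accPt_of_subset_isCompact hinf
    (isCompact_closedBall (0 : ℂ) R) (fun s hs => hs.1)
  rw [accPt_iff_frequently_nhdsNE] at hacc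
  have h0 := (hφ.analyticOnNhd isOpen_ball).eqOn_zero_of_preconnected_of_frequently_eq_zero
    (convex_ball _ _).isPreconnected (closedBall_subset_ball hRR hx)
    (hacc.mono fun s hs => hs.2)
  have hm : (R : ℂ) ∈ sphere (0 : ℂ) R := by simp [abs_of_pos hR]
  exact hne _ hm (h0 (closedBall_subset_ball hRR (sphere_subset_closedBall hm)))

theorem exists_zeros_multiset_circleIntegral {R R' : ℝ} (hR : 0 < R) (hRR : R < R') (n : ℕ) :
    ∀ φ : ℂ → ℂ, DifferentiableOn ℂ φ (ball 0 R') → (∀ s ∈ sphere (0 : ℂ) R, φ s ≠ 0) →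
    {s | s ∈ closedBall (0 : ℂ) R ∧ φ s = 0}.ncard = n →
    ∃ Z : Multiset ℂ, (∀ s ∈ closedBall (0 : ℂ) R, φ s = 0 ↔ s ∈ Z) ∧
      (∀ s ∈ Z, s ∈ ball (0 : ℂ) R) ∧
      ∀ ψ : ℂ → ℂ, DifferentiableOn ℂ ψ (ball 0 R') →
        (∮ s in C(0, R), ψ s * (deriv φ s / φ s)) = 2 * Real.pi * I * (Z.map ψ).sum := by
  have hsub : closedBall (0 : ℂ) R ⊆ ball 0 R' := closedBall_subset_ball hRR
  induction n with
  | zero =>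
    intro φ hφ hne hn
    rw [Set.ncard_eq_zero (finite_zeros_closedBall hR hRR hφ hne)] at hn
    have hz : ∀ s ∈ closedBall (0 : ℂ) R, φ s ≠ 0 := fun s hs h => by
      have : s ∈ {s | s ∈ closedBall (0 : ℂ) R ∧ φ s = 0} := ⟨hs, h⟩
      rw [hn] at this
      exact this
    refine ⟨0, fun s hs => by simp [hz s hs], by simp, fun ψ hψ => ?_⟩
    have hd : ∀ s ∈ closedBall (0 : ℂ) R,
        DifferentiableAt ℂ (fun s => ψ s * (deriv φ s / φ s)) s := fun s hs =>
      (hψ.differentiableAt (isOpen_ball.mem_nhds (hsub hs))).mul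
        (((hφ.deriv isOpen_ball).differentiableAt (isOpen_ball.mem_nhds (hsub hs))).div
        (hφ.differentiableAt (isOpen_ball.mem_nhds (hsub hs))) (hz s hs))
    rw [circleIntegral_eq_zero_of_differentiable_on_off_countable hR.le countable_empty
      (fun s hs => (hd s hs).continuousAt.continuousWithinAt)
      (fun s hs => hd s (ball_subset_closedBall hs.1))]
    simp
  | succ n ih =>
    intro φ hφ hne hn
    have hfin := finite_zeros_closedBall hR hRR hφ hne
    obtain ⟨a, haR, ha0⟩ : {s | s ∈ closedBall (0 : ℂ) R ∧ φ s = 0}.Nonempty := by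
      rw [Set.nonempty_iff_ne_empty]
      intro h
      rw [h, Set.ncard_empty] at hn
      omega
    have haB : a ∈ ball (0 : ℂ) R := by
      rw [← ball_union_sphere] at haR
      exact haR.resolve_right fun h => hne a h ha0
    have hnev : ¬ ∀ᶠ z in 𝓝 a, φ z = 0 := by
      intro h
      refine (infinite_of_mem_nhds a (s := {s | s ∈ closedBall (0 : ℂ) R ∧ φ s = 0}) ?_) hfin
      filter_upwards [h, isOpen_ball.mem_nhds haB] with z hz hz2
      exact ⟨ball_subset_closedBall hz2, hz⟩
    obtain ⟨m, g, hg, hga, hφg⟩ :=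
      exists_eq_pow_mul_of_differentiableOn isOpen_ball hφ (hsub haR) hnev
    have hm : m ≠ 0 := by
      rintro rfl
      rw [hφg] at ha0
      simp [hga] at ha0
    have hgne : ∀ s ∈ sphere (0 : ℂ) R, g s ≠ 0 := fun s hs h =>
      hne s hs (by rw [hφg, h, mul_zero])
    have hset : {s | s ∈ closedBall (0 : ℂ) R ∧ g s = 0}
        = {s | s ∈ closedBall (0 : ℂ) R ∧ φ s = 0} \ {a} := by
      ext s
      simp only [mem_ofPred_eq, Set.mem_sdiff, mem_singleton_iff]
      constructor
      · rintro ⟨h1, h2⟩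
        exact ⟨⟨h1, by rw [hφg, h2, mul_zero]⟩, fun h => hga (h ▸ h2)⟩
      · rintro ⟨⟨h1, h2⟩, h3⟩
        rw [hφg, mul_eq_zero] at h2
        exact ⟨h1, h2.resolve_left (pow_ne_zero _ (sub_ne_zero.2 h3))⟩
    obtain ⟨Z, hZ1, hZ2, hZ3⟩ := ih g hg hgne (by
      have hmem : a ∈ {s | s ∈ closedBall (0 : ℂ) R ∧ φ s = 0} := ⟨haR, ha0⟩
      rw [hset, Set.ncard_sdiff_singleton_of_mem hmem, hn]
      simp)
    refine ⟨Multiset.replicate m a + Z, ?_, ?_, ?_⟩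
    · intro s hs
      rw [Multiset.mem_add, Multiset.mem_replicate, ← hZ1 s hs, hφg, mul_eq_zero,
        pow_eq_zero_iff hm, sub_eq_zero]
      simp [hm]
    · intro s hs
      rw [Multiset.mem_add, Multiset.mem_replicate] at hs
      rcases hs with ⟨_, rfl⟩ | hs
      · exact haB
      · exact hZ2 s hs
    · intro ψ hψ
      have hsa : ∀ s ∈ sphere (0 : ℂ) R, s - a ≠ 0 := fun s hs h => by
        rw [sub_eq_zero] at h
        subst h
        rw [mem_ball] at haB
        rw [mem_sphere] at hs
        exact haB.ne hs
      have hφ_eq : φ = fun s => (s - a) ^ m * g s := funext hφg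
      have hlog : ∀ s ∈ sphere (0 : ℂ) R, ψ s * (deriv φ s / φ s)
          = m * (ψ s / (s - a)) + ψ s * (deriv g s / g s) := by
        intro s hs
        have hgd := (hg.differentiableAt
          (isOpen_ball.mem_nhds (hsub (sphere_subset_closedBall hs)))).hasDerivAt
        have hd := (((hasDerivAt_id s).sub_const a).pow m).mul hgd
        have : deriv φ s = m * (s - a) ^ (m - 1) * g s + (s - a) ^ m * deriv g s := by
          rw [hφ_eq]
          refine (HasDerivAt.deriv (hd.congr_deriv ?_))
          simp
        rw [this, hφg]
        have h1 := hsa s hs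
        have h2 := hgne s hs
        obtain ⟨k, rfl⟩ := Nat.exists_eq_succ_of_ne_zero hm
        simp only [Nat.succ_eq_add_one, Nat.add_sub_cancel]
        field_simp
        ring
      have hψc : ContinuousOn ψ (sphere 0 R) :=
        hψ.continuousOn.mono (sphere_subset_closedBall.trans hsub)
      have hi1 : CircleIntegrable (fun s => (m : ℂ) * (ψ s / (s - a))) 0 R :=
        (continuousOn_const.mul (hψc.div (by fun_prop) hsa)).circleIntegrable hR.le
      have hi2 : CircleIntegrable (fun s => ψ s * (deriv g s / g s)) 0 R :=
        (hψc.mul (((hg.deriv isOpen_ball).continuousOn.mono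
          (sphere_subset_closedBall.trans hsub)).div (hg.continuousOn.mono
          (sphere_subset_closedBall.trans hsub)) hgne)).circleIntegrable hR.le
      rw [circleIntegral.integral_congr hR.le hlog, circleIntegral.integral_add hi1 hi2, hZ3 ψ hψ,
        circleIntegral.integral_const_mul,
        circleIntegral_div_sub_of_differentiable_on_off_countable countable_empty haB
          (hψ.continuousOn.mono hsub) (fun x hx => hψ.differentiableAt
          (isOpen_ball.mem_nhds (hsub (ball_subset_closedBall hx.1))))]
      simp only [Multiset.map_add, Multiset.map_replicate, Multiset.sum_add,
        Multiset.sum_replicate, nsmul_eq_mul]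
      ring

theorem differentiableOn_deriv_fst {R R' δ M : ℝ} (hRR : R < R')
    {F : ℂ × ℂ → ℂ} (hF : DifferentiableOn ℂ F (ball 0 R' ×ˢ ball 0 δ))
    (hM : ∀ x ∈ ball (0 : ℂ) R' ×ˢ ball (0 : ℂ) δ, ‖F x‖ ≤ M) :
    ∀ s ∈ sphere (0 : ℂ) R,
      DifferentiableOn ℂ (fun t => deriv (fun s => F (s, t)) s) (ball 0 δ) ∧
      ∀ t ∈ ball (0 : ℂ) δ, ‖deriv (fun s => F (s, t)) s‖ ≤ M / ((R' - R) / 2) := by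
  intro s hs
  set r := (R' - R) / 2 with hr
  have hr0 : 0 < r := by rw [hr]; linarith
  have hsub : closedBall s r ⊆ ball 0 R' := by
    intro x hx
    rw [mem_closedBall] at hx
    rw [mem_sphere] at hs
    rw [mem_ball]
    linarith [dist_triangle x s 0]
  have hFs : ∀ t ∈ ball (0 : ℂ) δ, DifferentiableOn ℂ (fun s => F (s, t)) (ball 0 R') := by
    intro t ht
    exact hF.comp (by fun_prop) (fun x hx => ⟨hx, ht⟩)
  have hFt : ∀ s ∈ ball (0 : ℂ) R', DifferentiableOn ℂ (fun t => F (s, t)) (ball 0 δ) := by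
    intro s hs
    exact hF.comp (by fun_prop) (fun x hx => ⟨hs, hx⟩)
  have hsq : ∀ z ∈ sphere s r, (z - s) ^ 2 ≠ 0 := by
    intro z hz h
    rw [pow_eq_zero_iff two_ne_zero, sub_eq_zero] at h
    rw [h, mem_sphere, dist_self] at hz
    exact hr0.ne hz
  constructor
  · have hp := differentiableOn_circleIntegral_param (fun z t => ((z - s) ^ 2)⁻¹ • F (z, t)) s r δ
      ((r ^ 2)⁻¹ * M) hr0.le ?_ ?_ ?_
    · refine (hp.const_smul ((2 * Real.pi * I : ℂ)⁻¹)).congr fun t ht => ?_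
      exact (two_pi_I_inv_smul_circleIntegral_sub_sq_inv_smul_of_differentiable isOpen_ball hsub
        (hFs t ht) (mem_ball_self hr0)).symm
    · intro t ht
      refine ContinuousOn.smul (ContinuousOn.inv₀ (by fun_prop) hsq) ?_
      exact (hFs t ht).continuousOn.mono (sphere_subset_closedBall.trans hsub)
    · intro z hz
      exact (hFt z (hsub (sphere_subset_closedBall hz))).const_mul _
    · intro z hz t ht
      rw [norm_smul, norm_inv, norm_pow]
      have : ‖z - s‖ = r := by rw [← dist_eq_norm]; exact hz
      rw [this]
      exact mul_le_mul_of_nonneg_left (hM _ ⟨hsub (sphere_subset_closedBall hz), ht⟩)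
        (by positivity)
  · intro t ht
    apply Complex.norm_deriv_le_of_forall_mem_sphere_norm_le hr0
    · apply DifferentiableOn.diffContOnCl
      rw [closure_ball _ hr0.ne']
      exact (hFs t ht).mono hsub
    · intro z hz
      exact hM _ ⟨hsub (sphere_subset_closedBall hz), ht⟩

theorem differentiableOn_esymm {k : ℕ} {U : Set ℂ} (y : ℂ → Fin k → ℂ)
    (hp : ∀ m, DifferentiableOn ℂ (fun t => ∑ i, y t i ^ m) U) (j : ℕ) :
    DifferentiableOn ℂ (fun t => MvPolynomial.aeval (y t) (MvPolynomial.esymm (Fin k) ℂ j)) U := by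
  induction j using Nat.strong_induction_on with
  | _ j ih =>
    rcases Nat.eq_zero_or_pos j with rfl | hj
    · simp only [MvPolynomial.esymm_zero, map_one]
      exact differentiableOn_const _
    · have hN := fun t => congrArg (MvPolynomial.aeval (y t))
        (MvPolynomial.mul_esymm_eq_sum (Fin k) ℂ j)
      simp only [map_mul, map_natCast, map_pow, map_neg, map_one, map_sum] at hN
      have hj' : (j : ℂ) ≠ 0 := Nat.cast_ne_zero.2 hj.ne'
      have : (fun t => MvPolynomial.aeval (y t) (MvPolynomial.esymm (Fin k) ℂ j)) = fun t =>
          (j : ℂ)⁻¹ * ((-1) ^ (j + 1) * ∑ a ∈ Finset.HasAntidiagonal.antidiagonal j with a.1 < j,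
            (-1) ^ a.1 * MvPolynomial.aeval (y t) (MvPolynomial.esymm (Fin k) ℂ a.1) *
            MvPolynomial.aeval (y t) (MvPolynomial.psum (Fin k) ℂ a.2)) := by
        ext t
        rw [← hN t]
        field_simp
      rw [this]
      refine DifferentiableOn.const_mul (DifferentiableOn.const_mul
        (DifferentiableOn.fun_sum fun a ha => ?_) _) _
      refine DifferentiableOn.mul (DifferentiableOn.const_mul (ih a.1 ?_) _) ?_
      · exact (Finset.mem_filter.1 ha).2
      · simpa [MvPolynomial.psum] using hp a.2

theorem exists_eq_map_univ (Z : Multiset ℂ) (k : ℕ) (hk : Z.card = k) :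
    ∃ x : Fin k → ℂ, Z = Multiset.map x Finset.univ.val := by
  obtain ⟨l, rfl⟩ := Quot.exists_rep Z
  change (l : Multiset ℂ).card = k at hk
  rw [Multiset.coe_card] at hk
  subst hk
  refine ⟨l.get, ?_⟩
  rw [Fin.univ_val_map]
  exact congrArg _ (List.ofFn_get l).symm

theorem exists_resultant {R R' δ M c : ℝ} (hR : 0 < R) (hRR : R < R') (hc : 0 < c)
    {F G : ℂ × ℂ → ℂ} (hF : DifferentiableOn ℂ F (ball 0 R' ×ˢ ball 0 δ))
    (hG : DifferentiableOn ℂ G (ball 0 R' ×ˢ ball 0 δ))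
    (hFM : ∀ x ∈ ball (0 : ℂ) R' ×ˢ ball (0 : ℂ) δ, ‖F x‖ ≤ M)
    (hGM : ∀ x ∈ ball (0 : ℂ) R' ×ˢ ball (0 : ℂ) δ, ‖G x‖ ≤ M)
    (hFc : ∀ x ∈ sphere (0 : ℂ) R ×ˢ ball (0 : ℂ) δ, c ≤ ‖F x‖) :
    ∃ h : ℂ → ℂ, DifferentiableOn ℂ h (ball 0 δ) ∧
      ∀ t ∈ ball (0 : ℂ) δ, h t = 0 ↔ ∃ s ∈ ball (0 : ℂ) R, F (s, t) = 0 ∧ G (s, t) = 0 := by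
  have hsub : closedBall (0 : ℂ) R ⊆ ball 0 R' := closedBall_subset_ball hRR
  have hslice : ∀ {H : ℂ × ℂ → ℂ}, DifferentiableOn ℂ H (ball 0 R' ×ˢ ball 0 δ) →
      ∀ t ∈ ball (0 : ℂ) δ, DifferentiableOn ℂ (fun s => H (s, t)) (ball 0 R') :=
    fun hH t ht => hH.comp (by fun_prop) (fun x hx => ⟨hx, ht⟩)
  have hslice' : ∀ {H : ℂ × ℂ → ℂ}, DifferentiableOn ℂ H (ball 0 R' ×ˢ ball 0 δ) →
      ∀ s ∈ sphere (0 : ℂ) R, DifferentiableOn ℂ (fun t => H (s, t)) (ball 0 δ) :=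
    fun hH s hs => hH.comp (by fun_prop) (fun x hx => ⟨hsub (sphere_subset_closedBall hs), hx⟩)
  have hF0 : ∀ t ∈ ball (0 : ℂ) δ, ∀ s ∈ sphere (0 : ℂ) R, F (s, t) ≠ 0 := fun t ht s hs h => by
    have := hFc (s, t) ⟨hs, ht⟩
    rw [h, norm_zero] at this
    linarith
  have hZ : ∀ t ∈ ball (0 : ℂ) δ, _ := fun t ht =>
    exists_zeros_multiset_circleIntegral hR hRR _ (fun s => F (s, t)) (hslice hF t ht) (hF0 t ht) rfl
  choose! Z hZ1 hZ2 hZ3 using hZ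
  have hM0 : ∀ t ∈ ball (0 : ℂ) δ, 0 ≤ M := fun t ht =>
    (norm_nonneg _).trans (hFM (0, t) ⟨mem_ball_self (hR.trans hRR), ht⟩)
  have hσ : ∀ m : ℕ, DifferentiableOn ℂ (fun t => ((Z t).map (fun s => G (s, t) ^ m)).sum)
      (ball 0 δ) := by
    intro m
    have hd := differentiableOn_deriv_fst hRR hF hFM
    have hp := differentiableOn_circleIntegral_param
      (fun s t => G (s, t) ^ m * (deriv (fun s => F (s, t)) s / F (s, t))) 0 R δ
      (M ^ m * ((M / ((R' - R) / 2)) / c)) hR.le ?_ ?_ ?_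
    · refine (hp.const_mul ((2 * Real.pi * I : ℂ)⁻¹)).congr fun t ht => ?_
      rw [hZ3 t ht (fun s => G (s, t) ^ m) ((hslice hG t ht).pow m), inv_mul_cancel_left₀]
      simp [Real.pi_ne_zero, I_ne_zero]
    · intro t ht
      refine (((hslice hG t ht).pow m).continuousOn.mono
        (sphere_subset_closedBall.trans hsub)).mul ?_
      exact (((hslice hF t ht).deriv isOpen_ball).continuousOn.mono
        (sphere_subset_closedBall.trans hsub)).div ((hslice hF t ht).continuousOn.mono
        (sphere_subset_closedBall.trans hsub)) (hF0 t ht)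
    · intro s hs
      exact ((hslice' hG s hs).pow m).mul ((hd s hs).1.div (hslice' hF s hs)
        (fun t ht => hF0 t ht s hs))
    · intro s hs t ht
      have h1 : ‖G (s, t)‖ ≤ M := hGM _ ⟨hsub (sphere_subset_closedBall hs), ht⟩
      have h2 := (hd s hs).2 t ht
      have h3 := hFc _ (⟨hs, ht⟩ : (s, t) ∈ sphere (0 : ℂ) R ×ˢ ball (0 : ℂ) δ)
      rw [norm_mul, norm_pow, norm_div]
      have h4 := hM0 t ht
      gcongr
  have hcard : ∀ t ∈ ball (0 : ℂ) δ, ∀ t' ∈ ball (0 : ℂ) δ, (Z t).card = (Z t').card := by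
    intro t ht t' ht'
    refine (convex_ball (0 : ℂ) δ).isPreconnected.constant
      (f := fun t => (Z t).card) ?_ ht ht'
    rw [Nat.isClosedEmbedding_coe_real.isInducing.continuousOn_iff]
    refine (Complex.continuous_re.comp_continuousOn (hσ 0).continuousOn).congr fun t _ => ?_
    simp
  have hx : ∀ t ∈ ball (0 : ℂ) δ, ∃ x : Fin (Z 0).card → ℂ,
      Z t = Multiset.map x Finset.univ.val := by
    intro t ht
    have h0 : (0 : ℂ) ∈ ball (0 : ℂ) δ := mem_ball_self (pos_of_mem_ball ht)
    exact exists_eq_map_univ _ _ (hcard t ht 0 h0)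
  choose! x hx using hx
  have hes := differentiableOn_esymm (U := ball 0 δ) (fun t i => G (x t i, t)) (by
    intro m
    refine (hσ m).congr fun t ht => ?_
    rw [hx t ht, Multiset.map_map]
    rfl) (Z 0).card
  refine ⟨_, hes, fun t ht => ?_⟩
  have hprod : MvPolynomial.aeval (fun i => G (x t i, t))
      (MvPolynomial.esymm (Fin (Z 0).card) ℂ (Z 0).card) = ∏ i, G (x t i, t) := by
    have : MvPolynomial.esymm (Fin (Z 0).card) ℂ (Z 0).card = ∏ i, MvPolynomial.X i := by
      have h := Finset.powersetCard_self (Finset.univ : Finset (Fin (Z 0).card))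
      rw [Finset.card_univ, Fintype.card_fin] at h
      rw [MvPolynomial.esymm, h, Finset.sum_singleton]
    rw [this, map_prod]
    simp
  rw [hprod, Finset.prod_eq_zero_iff]
  constructor
  · rintro ⟨i, -, hi⟩
    have hmem : x t i ∈ Z t := by
      rw [hx t ht]
      exact Multiset.mem_map_of_mem _ (Finset.mem_univ_val i)
    exact ⟨x t i, hZ2 t ht _ hmem,
      (hZ1 t ht _ (ball_subset_closedBall (hZ2 t ht _ hmem))).2 hmem, hi⟩
  · rintro ⟨s, hs, h1, h2⟩
    have hmem := (hZ1 t ht s (ball_subset_closedBall hs)).1 h1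
    rw [hx t ht, Multiset.mem_map] at hmem
    obtain ⟨i, -, rfl⟩ := hmem
    exact ⟨i, Finset.mem_univ i, h2⟩

theorem exists_accPt_zeros_of_ne {F G : ℂ × ℂ → ℂ} {η : ℝ} (hη : 0 < η)
    (hF : DifferentiableOn ℂ F (ball 0 η)) (hG : DifferentiableOn ℂ G (ball 0 η))
    (hacc : AccPt (0 : ℂ × ℂ) (𝓟 {x | x ∈ ball (0 : ℂ × ℂ) η ∧ F x = 0 ∧ G x = 0}))
    (hne : ∀ᶠ s in 𝓝[≠] (0 : ℂ), F (s, 0) ≠ 0) {ε : ℝ} (hε : 0 < ε) :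
    ∃ (s : ℂ) (t : ℝ), ‖s‖ < ε ∧ 0 ≤ t ∧ t < ε ∧ (s, (t : ℂ)) ≠ 0 ∧
      AccPt (s, (t : ℂ)) (𝓟 {x | x ∈ ball (0 : ℂ × ℂ) η ∧ F x = 0 ∧ G x = 0}) := by
  rw [eventually_nhdsWithin_iff, Metric.eventually_nhds_iff] at hne
  obtain ⟨ρ, hρ, hne⟩ := hne
  obtain ⟨R', hR'0, hR'⟩ : ∃ R', 0 < R' ∧ R' < min (min ρ ε) η := by
    have : 0 < min (min ρ ε) η := by positivity
    exact ⟨_, half_pos this, half_lt_self this⟩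
  simp only [lt_min_iff] at hR'
  set R := R' / 2 with hR
  have hR0 : 0 < R := by positivity
  have hRR : R < R' := half_lt_self hR'0
  have hball : ball (0 : ℂ × ℂ) η = ball 0 η ×ˢ ball 0 η := (ball_prod_same 0 0 η).symm
  have hopen : IsOpen {x | x ∈ ball (0 : ℂ × ℂ) η ∧ F x ≠ 0} :=
    hF.continuousOn.isOpen_inter_preimage isOpen_ball isOpen_ne
  obtain ⟨u, v, -, hv, hsu, hzv, huv⟩ := generalized_tube_lemma (isCompact_sphere (0 : ℂ) R)
    (isCompact_singleton (x := (0 : ℂ))) hopen (by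
      rintro ⟨s, t⟩ ⟨hs, ht⟩
      simp only [mem_singleton_iff] at ht
      simp only [mem_sphere] at hs
      subst ht
      refine ⟨?_, ?_⟩
      · rw [hball]
        refine ⟨?_, mem_ball_self hη⟩
        rw [mem_ball]
        linarith
      · refine hne (by linarith) ?_
        rintro rfl
        rw [dist_self] at hs
        linarith)
  obtain ⟨δ₀, hδ₀, hδv⟩ := Metric.isOpen_iff.1 hv 0 (hzv rfl)
  obtain ⟨δ, hδ0, hδ⟩ : ∃ δ, 0 < δ ∧ δ < min (min δ₀ ε) η := by
    have : 0 < min (min δ₀ ε) η := by positivity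
    exact ⟨_, half_pos this, half_lt_self this⟩
  simp only [lt_min_iff] at hδ
  have hK1 : IsCompact (sphere (0 : ℂ) R ×ˢ closedBall (0 : ℂ) δ) :=
    (isCompact_sphere _ _).prod (isCompact_closedBall _ _)
  have hK2 : IsCompact (closedBall (0 : ℂ) R' ×ˢ closedBall (0 : ℂ) δ) :=
    (isCompact_closedBall _ _).prod (isCompact_closedBall _ _)
  have hK2s : closedBall (0 : ℂ) R' ×ˢ closedBall (0 : ℂ) δ ⊆ ball (0 : ℂ × ℂ) η := by
    rw [hball]
    exact Set.prod_mono (closedBall_subset_ball hR'.2) (closedBall_subset_ball hδ.2)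
  have hK1s : sphere (0 : ℂ) R ×ˢ closedBall (0 : ℂ) δ ⊆ ball (0 : ℂ × ℂ) η :=
    (Set.prod_mono (sphere_subset_closedBall.trans (closedBall_subset_closedBall hRR.le))
      Subset.rfl).trans hK2s
  obtain ⟨c, hc, hFc⟩ : ∃ c > 0, ∀ x ∈ sphere (0 : ℂ) R ×ˢ closedBall (0 : ℂ) δ, c ≤ ‖F x‖ := by
    obtain ⟨x, hx, hmin⟩ := hK1.exists_isMinOn
      (⟨((R : ℂ), 0), by simp [abs_of_pos hR0, hδ0.le]⟩)
      (hF.continuousOn.mono hK1s).norm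
    refine ⟨‖F x‖, norm_pos_iff.2 ?_, fun y hy => hmin hy⟩
    exact (huv ⟨hsu hx.1, hδv (closedBall_subset_ball hδ.1.1 hx.2)⟩).2
  obtain ⟨M1, hM1⟩ := hK2.exists_bound_of_continuousOn (hF.continuousOn.mono hK2s)
  obtain ⟨M2, hM2⟩ := hK2.exists_bound_of_continuousOn (hG.continuousOn.mono hK2s)
  have hsubs : ball (0 : ℂ) R' ×ˢ ball (0 : ℂ) δ ⊆ closedBall (0 : ℂ) R' ×ˢ closedBall (0 : ℂ) δ :=
    Set.prod_mono ball_subset_closedBall ball_subset_closedBall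
  obtain ⟨h, hh, hiff⟩ := exists_resultant (M := max M1 M2) hR0 hRR hc
    (hF.mono (hsubs.trans hK2s)) (hG.mono (hsubs.trans hK2s))
    (fun x hx => (hM1 x (hsubs hx)).trans (le_max_left _ _))
    (fun x hx => (hM2 x (hsubs hx)).trans (le_max_right _ _))
    (fun x hx => hFc x ⟨hx.1, ball_subset_closedBall hx.2⟩)
  have hfreq : ∃ᶠ t in 𝓝[≠] (0 : ℂ), h t = 0 := by
    intro hev
    rw [eventually_nhdsWithin_iff] at hev
    rw [accPt_iff_frequently] at hacc
    have h1 : ∀ᶠ y : ℂ × ℂ in 𝓝 0, y.2 ≠ 0 → ¬ h y.2 = 0 :=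
      (continuous_snd.tendsto (0 : ℂ × ℂ)).eventually hev
    have h2 : ∀ᶠ y : ℂ × ℂ in 𝓝 0, y ∈ ball (0 : ℂ × ℂ) (min R δ) :=
      ball_mem_nhds _ (by positivity)
    obtain ⟨⟨s, t⟩, ⟨hy0, hyB, hyF, hyG⟩, h1, h2⟩ := (hacc.and_eventually (h1.and h2)).exists
    obtain ⟨hs, ht⟩ : (s, t) ∈ ball (0 : ℂ) (min R δ) ×ˢ ball (0 : ℂ) (min R δ) := by
      rw [ball_prod_same]
      exact h2
    have hs' := ball_subset_ball (min_le_left _ _) hs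
    have ht' := ball_subset_ball (min_le_right _ _) ht
    by_cases ht0 : t = 0
    · subst ht0
      refine hne (y := s) ?_ ?_ hyF
      · rw [mem_ball] at hs'
        linarith
      · rintro rfl
        exact hy0 rfl
    · exact h1 ht0 ((hiff t ht').2 ⟨s, hs', hyF, hyG⟩)
  have hzero := (hh.analyticOnNhd isOpen_ball).eqOn_zero_of_preconnected_of_frequently_eq_zero
    (convex_ball _ _).isPreconnected (mem_ball_self hδ0) hfreq
  have hS : ∀ t ∈ ball (0 : ℂ) δ, _ := fun t ht => (hiff t ht).1 (hzero ht)
  choose! S hSR hSF hSG using hS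
  have ht0 : ((δ / 2 : ℝ) : ℂ) ∈ ball (0 : ℂ) δ := by
    rw [mem_ball_zero_iff, norm_real, Real.norm_eq_abs, abs_of_pos (by positivity)]
    linarith
  have hev : ∀ᶠ t in 𝓝[≠] ((δ / 2 : ℝ) : ℂ), t ∈ ball (0 : ℂ) δ :=
    nhdsWithin_le_nhds (isOpen_ball.mem_nhds ht0)
  obtain ⟨s', hs', hcl⟩ := (isCompact_closedBall (0 : ℂ) R).exists_mapClusterPt_of_frequently
    (l := 𝓝[≠] ((δ / 2 : ℝ) : ℂ)) (f := S) (by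
      refine Eventually.frequently ?_
      filter_upwards [hev] with t ht
      exact ball_subset_closedBall (hSR t ht))
  refine ⟨s', δ / 2, ?_, by positivity, by linarith, ?_, ?_⟩
  · rw [mem_closedBall_zero_iff] at hs'
    linarith
  · intro h0
    have := congrArg Prod.snd h0
    simp only [Prod.snd_zero, ofReal_eq_zero] at this
    linarith
  · rw [accPt_iff_frequently]
    intro hcon
    rw [nhds_prod_eq] at hcon
    obtain ⟨p, hp, q, hq, hpq⟩ := Filter.eventually_prod_iff.1 hcon
    have hf := (mapClusterPt_iff_frequently.1 hcl) _ hp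
    have hq' : ∀ᶠ t in 𝓝[≠] ((δ / 2 : ℝ) : ℂ), q t := nhdsWithin_le_nhds hq
    have hn : ∀ᶠ t in 𝓝[≠] ((δ / 2 : ℝ) : ℂ), t ≠ ((δ / 2 : ℝ) : ℂ) := self_mem_nhdsWithin
    obtain ⟨t, htp, htq, htb, htn⟩ := (hf.and_eventually (hq'.and (hev.and hn))).exists
    refine hpq htp htq ⟨fun h => htn (congrArg Prod.snd h), ?_, hSF t htb, hSG t htb⟩
    exact hK2s (hsubs ⟨ball_subset_ball hRR.le (hSR t htb), htb⟩)

theorem exists_accPt_zeros {F G : ℂ × ℂ → ℂ} {η : ℝ} (hη : 0 < η)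
    (hF : DifferentiableOn ℂ F (ball 0 η)) (hG : DifferentiableOn ℂ G (ball 0 η))
    (hacc : AccPt (0 : ℂ × ℂ) (𝓟 {x | x ∈ ball (0 : ℂ × ℂ) η ∧ F x = 0 ∧ G x = 0}))
    {ε : ℝ} (hε : 0 < ε) :
    ∃ (s : ℂ) (t : ℝ), ‖s‖ < ε ∧ 0 ≤ t ∧ t < ε ∧ (s, (t : ℂ)) ≠ 0 ∧
      AccPt (s, (t : ℂ)) (𝓟 {x | x ∈ ball (0 : ℂ × ℂ) η ∧ F x = 0 ∧ G x = 0}) := by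
  have hball : ball (0 : ℂ × ℂ) η = ball 0 η ×ˢ ball 0 η := (ball_prod_same 0 0 η).symm
  have han : ∀ {H : ℂ × ℂ → ℂ}, DifferentiableOn ℂ H (ball 0 η) →
      AnalyticAt ℂ (fun s => H (s, 0)) (0 : ℂ) := fun {H} hH => by
    have : DifferentiableOn ℂ (fun s : ℂ => H (s, 0)) (ball 0 η) :=
      hH.comp (f := fun s : ℂ => (s, (0 : ℂ))) (by fun_prop) (fun x hx => by
        rw [hball]
        exact ⟨hx, mem_ball_self hη⟩)
    exact this.analyticAt (ball_mem_nhds _ hη)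
  rcases (han hF).eventually_eq_zero_or_eventually_ne_zero with hF0 | hF0
  · rcases (han hG).eventually_eq_zero_or_eventually_ne_zero with hG0 | hG0
    · obtain ⟨ρ, hρ, hρ0⟩ := Metric.eventually_nhds_iff_ball.1 (hF0.and hG0)
      obtain ⟨s, hs0, hs⟩ : ∃ s : ℝ, 0 < s ∧ s < min (min ρ ε) η := by
        have : 0 < min (min ρ ε) η := by positivity
        exact ⟨_, half_pos this, half_lt_self this⟩
      simp only [lt_min_iff] at hs
      have hns : ‖(s : ℂ)‖ = s := by rw [norm_real, Real.norm_eq_abs, abs_of_pos hs0]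
      refine ⟨s, 0, by rw [hns]; exact hs.1.2, le_rfl, hε, ?_, ?_⟩
      · intro h0
        have := congrArg Prod.fst h0
        simp only [Prod.fst_zero, ofReal_eq_zero] at this
        linarith
      · rw [accPt_iff_frequently]
        have ht : Tendsto (fun z : ℂ => (z, ((0 : ℝ) : ℂ))) (𝓝[≠] (s : ℂ))
            (𝓝 ((s : ℂ), ((0 : ℝ) : ℂ))) :=
          (Continuous.tendsto (by fun_prop) (s : ℂ)).mono_left nhdsWithin_le_nhds
        refine ht.frequently (Eventually.frequently ?_)
        have h1 : ∀ᶠ z in 𝓝[≠] (s : ℂ), z ∈ ball (0 : ℂ) ρ := nhdsWithin_le_nhds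
          (isOpen_ball.mem_nhds (by rw [mem_ball_zero_iff, hns]; exact hs.1.1))
        have h2 : ∀ᶠ z in 𝓝[≠] (s : ℂ), z ∈ ball (0 : ℂ) η := nhdsWithin_le_nhds
          (isOpen_ball.mem_nhds (by rw [mem_ball_zero_iff, hns]; exact hs.2))
        filter_upwards [h1, h2, self_mem_nhdsWithin] with z hz hz2 hzn
        refine ⟨fun h => hzn (congrArg Prod.fst h), ?_, ?_, ?_⟩
        · rw [hball]
          exact ⟨hz2, by simpa using hη⟩
        · simpa using (hρ0 z hz).1
        · simpa using (hρ0 z hz).2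
    · have hset : {x | x ∈ ball (0 : ℂ × ℂ) η ∧ F x = 0 ∧ G x = 0}
          = {x | x ∈ ball (0 : ℂ × ℂ) η ∧ G x = 0 ∧ F x = 0} := by
        ext x
        simp [and_comm]
      rw [hset] at hacc ⊢
      exact exists_accPt_zeros_of_ne hη hG hF hacc hG0 hε
  · exact exists_accPt_zeros_of_ne hη hF hG hacc hF0 hε

/-- `A` cannot have an isolated point along the real half-hyperplanes of holomorphic charts. -/
def HasHalfSpacePoints (A : Set C2) : Prop :=
  ∀ b ∈ A, ∀ Ψ : C2 ≃ₜ C2, Differentiable ℂ Ψ → Ψ 0 = b → ∀ δ > 0,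
    ∃ (s : ℂ) (t : ℝ), ‖s‖ < δ ∧ 0 ≤ t ∧ t < δ ∧ (s, (t : ℂ)) ≠ 0 ∧ Ψ (s, (t : ℂ)) ∈ A

theorem hasHalfSpacePoints_accPt {f : C2 → C2} {G : Set C2} (hG : IsOpen G)
    (hf : DifferentiableOn ℂ f G) (c : C2) :
    HasHalfSpacePoints {x | x ∈ G ∧ f x = c ∧ AccPt x (𝓟 {y | y ∈ G ∧ f y = c})} := by
  rintro b ⟨hbG, hbc, hacc⟩ Ψ hΨ rfl δ hδ
  obtain ⟨η, hη, hηG⟩ := Metric.isOpen_iff.1 (hG.preimage Ψ.continuous) 0 hbG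
  have hcomp : DifferentiableOn ℂ (fun x => f (Ψ x)) (ball 0 η) :=
    hf.comp hΨ.differentiableOn hηG
  have hF : DifferentiableOn ℂ (fun x => (f (Ψ x)).1 - c.1) (ball 0 η) :=
    hcomp.fst.sub_const _
  have hF' : DifferentiableOn ℂ (fun x => (f (Ψ x)).2 - c.2) (ball 0 η) :=
    hcomp.snd.sub_const _
  have hset : {x | x ∈ ball (0 : ℂ × ℂ) η ∧ (f (Ψ x)).1 - c.1 = 0 ∧ (f (Ψ x)).2 - c.2 = 0}
      = {x | x ∈ ball (0 : ℂ × ℂ) η ∧ f (Ψ x) = c} := by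
    ext x
    simp [sub_eq_zero, Prod.ext_iff]
  have hAcc : ∀ x ∈ ball (0 : C2) η, AccPt x (𝓟 {x | x ∈ ball (0 : ℂ × ℂ) η ∧ f (Ψ x) = c}) ↔
      AccPt (Ψ x) (𝓟 {y | y ∈ G ∧ f y = c}) := by
    intro x hx
    rw [accPt_iff_frequently, accPt_iff_frequently, ← Ψ.map_nhds_eq, frequently_map]
    constructor
    · intro h
      refine h.mono fun y hy => ⟨Ψ.injective.ne hy.1, hηG hy.2.1, hy.2.2⟩
    · intro h
      refine (h.and_eventually (isOpen_ball.mem_nhds hx)).mono fun y hy => ⟨?_, hy.2, hy.1.2.2⟩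
      rintro rfl
      exact hy.1.1 rfl
  obtain ⟨s, t, hs, ht0, ht, hne, hst⟩ := exists_accPt_zeros hη hF hF' (by
    rw [hset]
    exact (hAcc 0 (mem_ball_self hη)).2 hacc) (lt_min hδ hη)
  rw [hset] at hst
  have hmem : (s, (t : ℂ)) ∈ ball (0 : C2) η := by
    rw [mem_ball_zero_iff, Prod.norm_def]
    simp only [norm_real, Real.norm_eq_abs, abs_of_nonneg ht0, sup_lt_iff]
    exact ⟨hs.trans_le (min_le_right _ _), ht.trans_le (min_le_right _ _)⟩
  refine ⟨s, t, hs.trans_le (min_le_left _ _), ht0, ht.trans_le (min_le_left _ _), hne,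
    hηG hmem, ?_, (hAcc _ hmem).1 hst⟩
  by_contra hcon
  have hc := hcomp.continuousOn.continuousAt (isOpen_ball.mem_nhds hmem)
  rw [accPt_iff_frequently] at hst
  obtain ⟨y, ⟨-, -, hy⟩, hy'⟩ := (hst.and_eventually
    (hc.eventually (isOpen_ne.mem_nhds hcon))).exists
  exact hy' hy

/-- The affine change of coordinates adapted to the gradient of the peak function. -/
def shearHomeomorph (s t a k : ℂ) (hk : k ≠ 0) : C2 ≃ₜ C2 where
  toFun x := (s + x.1, t + (x.2 - a * x.1) / k)
  invFun y := (y.1 - s, k * (y.2 - t) + a * (y.1 - s))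
  left_inv x := by
    ext
    · simp
    · simp only [add_sub_cancel_left]
      field_simp
      ring
  right_inv y := by
    ext
    · simp
    · simp only [add_sub_cancel_right]
      field_simp
      ring
  continuous_toFun := by fun_prop
  continuous_invFun := by fun_prop

/-- The upper limit of a sequence of sets. -/
def limsupSet (A : ℕ → Set C2) : Set C2 :=
  {x | ∀ W ∈ 𝓝 x, ∃ᶠ n in atTop, (A n ∩ W).Nonempty}

theorem peak_increment {C α η τ x y : ℝ} (hC : 0 ≤ C) (hα : 0 < α) (hτ : 0 ≤ τ)
    (hy : 0 ≤ y) (hyx : y ≤ 2 * (τ + 2 * α * η * x)) (hτC : 16 * C * τ ≤ 1)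
    (hη : 64 * C * α * η ^ 2 ≤ 1) : τ / 2 + α * x ^ 2 / 2 ≤ τ + α * x ^ 2 - C * y ^ 2 := by
  have h1 : y ^ 2 ≤ 8 * τ ^ 2 + 8 * (2 * α * η * x) ^ 2 := by
    have : y ^ 2 ≤ (2 * (τ + 2 * α * η * x)) ^ 2 := by gcongr
    linarith [sq_nonneg (τ - 2 * α * η * x), add_sq τ (2 * α * η * x), sub_sq τ (2 * α * η * x),
      mul_pow 2 (τ + 2 * α * η * x) 2]
  have e1 : C * y ^ 2 ≤ C * (8 * τ ^ 2 + 8 * (2 * α * η * x) ^ 2) := by gcongr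
  have e2 : 16 * C * τ * τ ≤ 1 * τ := by gcongr
  have e3 : 64 * C * α * η ^ 2 * (α * x ^ 2) ≤ 1 * (α * x ^ 2) := by gcongr
  linarith

theorem not_peak {A : ℕ → Set C2} {B : Set C2} (hB : IsOpen B)
    (hAK : ∀ n, ∀ K ⊆ B, IsCompact K → IsCompact (A n ∩ K))
    (hT : ∀ n, HasHalfSpacePoints (A n)) {q : C2} (hq : q ∈ limsupSet A) (hqB : q ∈ B)
    (Φ : C2 ≃ₜ C2) (hΦ : Differentiable ℂ Φ) (hΦ0 : Φ 0 = q) {α C δ : ℝ} (hα : 0 < α)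
    (hC : 0 ≤ C) (hδ : 0 < δ)
    (hneg : ∀ x : C2, x ≠ 0 → ‖x‖ < δ → Φ x ∈ limsupSet A →
      x.2.re + α * ‖x.1‖ ^ 2 - C * ‖x.2‖ ^ 2 < 0) : False := by
  set u : C2 → ℝ := fun x => x.2.re + α * ‖x.1‖ ^ 2 - C * ‖x.2‖ ^ 2 with hu
  have hucont : Continuous u := by
    have : Continuous fun x : C2 => x.2.re := Complex.continuous_re.comp continuous_snd
    fun_prop
  obtain ⟨δ₁, hδ₁, hδ₁B⟩ := Metric.isOpen_iff.1 (hB.preimage Φ.continuous) 0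
    (by rw [mem_preimage, hΦ0]; exact hqB)
  obtain ⟨δ', hδ'0, hδ'⟩ : ∃ δ', 0 < δ' ∧ δ' < min δ δ₁ :=
    ⟨_, half_pos (lt_min hδ hδ₁), half_lt_self (lt_min hδ hδ₁)⟩
  rw [lt_min_iff] at hδ'
  obtain ⟨η, ⟨h1, h2, h3⟩, hη0⟩ : ∃ η : ℝ, (4 * C * η < 1 ∧ 64 * C * α * η ^ 2 < 1 ∧ η < δ') ∧
      0 < η := by
    have e1 : ∀ᶠ η in 𝓝 (0 : ℝ), 4 * C * η < 1 :=
      (Continuous.tendsto (by fun_prop : Continuous fun η : ℝ => 4 * C * η) 0).eventually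
        (isOpen_Iio.mem_nhds (by simp))
    have e2 : ∀ᶠ η in 𝓝 (0 : ℝ), 64 * C * α * η ^ 2 < 1 :=
      (Continuous.tendsto (by fun_prop : Continuous fun η : ℝ => 64 * C * α * η ^ 2) 0).eventually
        (isOpen_Iio.mem_nhds (by simp))
    have e3 : ∀ᶠ η in 𝓝[>] (0 : ℝ), (4 * C * η < 1 ∧ 64 * C * α * η ^ 2 < 1 ∧ η < δ') ∧
        0 < η := by
      filter_upwards [nhdsWithin_le_nhds e1, nhdsWithin_le_nhds e2,
        nhdsWithin_le_nhds (isOpen_Iio.mem_nhds hδ'0), self_mem_nhdsWithin] with η a b c d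
      exact ⟨⟨a, b, c⟩, d⟩
    exact e3.exists
  have hΦB : Φ '' closedBall 0 δ' ⊆ B := by
    rintro _ ⟨x, hx, rfl⟩
    exact hδ₁B (closedBall_subset_ball hδ'.2 hx)
  -- away from the origin `u` is uniformly negative along the sequence
  obtain ⟨κ, hκ, hκn⟩ : ∃ κ > 0, ∀ᶠ n in atTop,
      ∀ x ∈ closedBall (0 : C2) δ' \ ball 0 η, Φ x ∈ A n → u x < -κ := by
    refine IsCompact.induction_on (p := fun S => ∃ κ > 0, ∀ᶠ n in atTop,
      ∀ x ∈ S, Φ x ∈ A n → u x < -κ)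
      ((isCompact_closedBall (0 : C2) δ').diff isOpen_ball) ?_ ?_ ?_ ?_
    · exact ⟨1, one_pos, by simp⟩
    · rintro S S' hSS ⟨κ, hκ, h⟩
      exact ⟨κ, hκ, h.mono fun n hn x hx => hn x (hSS hx)⟩
    · rintro S S' ⟨κ, hκ, h⟩ ⟨κ', hκ', h'⟩
      refine ⟨min κ κ', lt_min hκ hκ', (h.and h').mono fun n hn x hx hxn => ?_⟩
      rcases hx with hx | hx
      · have := hn.1 x hx hxn
        linarith [min_le_left κ κ']
      · have := hn.2 x hx hxn
        linarith [min_le_right κ κ']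
    · rintro x ⟨hx, hxη⟩
      rw [mem_closedBall_zero_iff] at hx
      by_cases hxL : Φ x ∈ limsupSet A
      · have hx0 : x ≠ 0 := by
          rintro rfl
          exact hxη (mem_ball_self hη0)
        have hux : u x < 0 := hneg x hx0 (by linarith) hxL
        refine ⟨{y | u y < u x / 2}, mem_nhdsWithin_of_mem_nhds
          ((isOpen_Iio.preimage hucont).mem_nhds ?_), -(u x / 2), by linarith,
          Eventually.of_forall fun n y hy _ => by simpa using hy⟩
        change u x < u x / 2
        linarith
      · have : ∃ W ∈ 𝓝 (Φ x), ∀ᶠ n in atTop, ¬ (A n ∩ W).Nonempty := by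
          by_contra hcon
          push Not at hcon
          exact hxL hcon
        obtain ⟨W, hW, hWn⟩ := this
        refine ⟨Φ ⁻¹' W, mem_nhdsWithin_of_mem_nhds (Φ.continuous.continuousAt hW), 1, one_pos,
          hWn.mono fun n hn y hy hyn => (hn ⟨_, hyn, hy⟩).elim⟩
  have hnear : ∃ᶠ n in atTop, ∃ x : C2, Φ x ∈ A n ∧ ‖x‖ < η ∧ -κ < u x := by
    have hW : Φ '' {x | ‖x‖ < η ∧ -κ < u x} ∈ 𝓝 q := by
      rw [← hΦ0]
      refine Φ.isOpenMap.image_mem_nhds ?_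
      refine IsOpen.mem_nhds ((isOpen_Iio.preimage continuous_norm).inter
        (isOpen_Ioi.preimage hucont)) ⟨by simpa using hη0, ?_⟩
      simpa [hu] using hκ
    refine (hq _ hW).mono ?_
    rintro n ⟨_, hy, x, hx, rfl⟩
    exact ⟨x, hy, hx⟩
  obtain ⟨n, ⟨x₀, hx₀, hx₀η, hx₀κ⟩, hn⟩ := (hnear.and_eventually hκn).exists
  have hKc : IsCompact (closedBall (0 : C2) δ' ∩ Φ ⁻¹' (A n)) := by
    have h := hAK n _ hΦB ((isCompact_closedBall (0 : C2) δ').image Φ.continuous)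
    have h' := h.image Φ.symm.continuous
    convert h' using 1
    ext x
    constructor
    · rintro ⟨ha, hb⟩
      exact ⟨Φ x, ⟨hb, x, ha, rfl⟩, Φ.symm_apply_apply x⟩
    · rintro ⟨_, ⟨ha, y, hy, rfl⟩, rfl⟩
      rw [Φ.symm_apply_apply]
      exact ⟨hy, ha⟩
  obtain ⟨⟨s, t⟩, ⟨hbδ, hbA⟩, hmax⟩ := hKc.exists_isMaxOn
    ⟨x₀, mem_closedBall_zero_iff.2 (by linarith), hx₀⟩ hucont.continuousOn
  have hub : -κ < u (s, t) := hx₀κ.trans_le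
    (hmax ⟨mem_closedBall_zero_iff.2 (by linarith), hx₀⟩)
  have hbη : ‖((s, t) : C2)‖ < η := by
    by_contra hcon
    have := hn (s, t) ⟨hbδ, by rwa [mem_ball_zero_iff]⟩ hbA
    linarith
  have hsη : ‖s‖ < η := (norm_fst_le (s, t)).trans_lt hbη
  have htη : ‖t‖ < η := (norm_snd_le (s, t)).trans_lt hbη
  set k : ℂ := 1 - 2 * C * (starRingEnd ℂ) t with hk
  have hk2 : 1 / 2 ≤ ‖k‖ := by
    have h4 : ‖(2 * C * (starRingEnd ℂ) t : ℂ)‖ ≤ 1 / 2 := by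
      rw [norm_mul, norm_mul, RCLike.norm_conj, norm_real, Real.norm_eq_abs, abs_of_nonneg hC,
        Complex.norm_ofNat]
      nlinarith
    have h5 := norm_sub_norm_le (1 : ℂ) (2 * C * (starRingEnd ℂ) t)
    rw [norm_one] at h5
    linarith
  have hk0 : k ≠ 0 := by
    intro h
    rw [h, norm_zero] at hk2
    linarith
  set a : ℂ := 2 * α * (starRingEnd ℂ) s with ha
  set T := shearHomeomorph s t a k hk0
  have hT0 : T 0 = (s, t) := by
    simp [T, shearHomeomorph]
  obtain ⟨ε, hε, hεT⟩ := Metric.isOpen_iff.1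
    ((isOpen_ball (x := (0 : C2)) (ε := η)).preimage T.continuous) 0
    (by rw [mem_preimage, hT0]; exact mem_ball_zero_iff.2 hbη)
  have hTd : Differentiable ℂ T := by
    change Differentiable ℂ fun x : C2 => (s + x.1, t + (x.2 - a * x.1) / k)
    fun_prop
  obtain ⟨σ, τ, hσ, hτ0, hτ, hne, hmem⟩ := hT n (Φ (s, t)) hbA (T.trans Φ) (hΦ.comp hTd)
    (by rw [Homeomorph.trans_apply, hT0])
    (min ε (1 / (16 * (C + 1)))) (by positivity)
  rw [lt_min_iff] at hσ hτ
  have hin : T (σ, (τ : ℂ)) ∈ ball (0 : C2) η := by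
    apply hεT
    rw [mem_ball_zero_iff, Prod.norm_def]
    simp only [norm_real, Real.norm_eq_abs, abs_of_nonneg hτ0, sup_lt_iff]
    exact ⟨hσ.1, hτ.1⟩
  have hle : u (T (σ, (τ : ℂ))) ≤ u (s, t) :=
    hmax ⟨ball_subset_closedBall (ball_subset_ball h3.le hin), hmem⟩
  set w : ℂ := ((τ : ℂ) - a * σ) / k with hw
  have hTval : T (σ, (τ : ℂ)) = (s + σ, t + w) := rfl
  have hkw : k * w = τ - a * σ := by
    rw [hw]
    field_simp
  have hdiff : u (s + σ, t + w) - u (s, t) = τ + α * ‖σ‖ ^ 2 - C * ‖w‖ ^ 2 := by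
    have hre := congrArg Complex.re hkw
    simp only [hk, ha] at hre
    simp only [hu, ← Complex.normSq_eq_norm_sq, Complex.normSq_apply]
    simp at hre ⊢
    linear_combination hre
  have hwn : ‖w‖ ≤ 2 * (τ + 2 * α * η * ‖σ‖) := by
    have e1 : ‖k‖ * ‖w‖ ≤ τ + 2 * α * η * ‖σ‖ := by
      rw [← norm_mul, hkw]
      refine (norm_sub_le _ _).trans ?_
      rw [norm_real, Real.norm_eq_abs, abs_of_nonneg hτ0, norm_mul, ha, norm_mul, norm_mul,
        RCLike.norm_conj, norm_real, Real.norm_eq_abs, abs_of_pos hα, Complex.norm_ofNat]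
      have := norm_nonneg σ
      gcongr
    nlinarith [norm_nonneg w]
  have hτC : 16 * C * τ ≤ 1 := by
    have e := hτ.2
    rw [lt_div_iff₀ (by positivity)] at e
    nlinarith
  have hfin : τ / 2 + α * ‖σ‖ ^ 2 / 2 ≤ 0 := by
    rw [hTval] at hle
    have := peak_increment hC hα hτ0 (norm_nonneg w) hwn hτC h2.le
    linarith
  apply hne
  have hα2 : 0 ≤ α * ‖σ‖ ^ 2 := by positivity
  have hτz : τ = 0 := by linarith
  have hσz : α * ‖σ‖ ^ 2 = 0 := by linarith
  have : σ = 0 := by simpa [hα.ne'] using hσz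
  simp [this, hτz]

/-- The space in which a real analytic function on `ℂ²` is polarised, with coordinates
`((z, w, χ), τ)`. -/
abbrev PolSpace := (C2 × ℂ) × ℂ

/-- The totally real embedding `(z, w) ↦ ((z, w, z̄), w̄)`. -/
def polEmb (x : C2) : PolSpace := ((x, (starRingEnd ℂ) x.1), (starRingEnd ℂ) x.2)

/-- The conjugation `((z, w, χ), τ) ↦ ((χ̄, τ̄, z̄), w̄)` fixing the image of `polEmb`. -/
def polConj (x : PolSpace) : PolSpace :=
  ((((starRingEnd ℂ) x.1.2, (starRingEnd ℂ) x.2), (starRingEnd ℂ) x.1.1.1),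
    (starRingEnd ℂ) x.1.1.2)

/-- The complexified real coordinates of `ℂ²`. -/
def polCoord (i : Fin 4) : PolSpace →L[ℂ] ℂ :=
  let z := ContinuousLinearMap.fst ℂ ℂ ℂ ∘L ContinuousLinearMap.fst ℂ C2 ℂ ∘L
    ContinuousLinearMap.fst ℂ (C2 × ℂ) ℂ
  let w := ContinuousLinearMap.snd ℂ ℂ ℂ ∘L ContinuousLinearMap.fst ℂ C2 ℂ ∘L
    ContinuousLinearMap.fst ℂ (C2 × ℂ) ℂ
  let χ := ContinuousLinearMap.snd ℂ C2 ℂ ∘L ContinuousLinearMap.fst ℂ (C2 × ℂ) ℂ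
  let τ := ContinuousLinearMap.snd ℂ (C2 × ℂ) ℂ
  ![(1 / 2 : ℂ) • (z + χ), (-I / 2 : ℂ) • (z - χ), (1 / 2 : ℂ) • (w + τ),
    (-I / 2 : ℂ) • (w - τ)] i

/-- The standard real basis of `ℂ²`. -/
def realBasisVec (i : Fin 4) : C2 := ![(1, 0), (I, 0), (0, 1), (0, I)] i

theorem norm_realBasisVec (i : Fin 4) : ‖realBasisVec i‖ ≤ 1 := by
  fin_cases i <;> simp [realBasisVec, Prod.norm_def]

/-- The real coordinates of a point of `ℂ²`. -/
def realCoord (i : Fin 4) (x : C2) : ℝ := ![x.1.re, x.1.im, x.2.re, x.2.im] i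

theorem sum_realCoord (x : C2) : ∑ i, realCoord i x • realBasisVec i = x := by
  simp only [Fin.sum_univ_four, realCoord, realBasisVec]
  apply Prod.ext <;> apply Complex.ext <;> simp

theorem polCoord_polEmb (i : Fin 4) (x : C2) : polCoord i (polEmb x) = realCoord i x := by
  fin_cases i <;> apply Complex.ext <;> simp [polCoord, polEmb, realCoord] <;> ring

theorem polCoord_polConj (i : Fin 4) (x : PolSpace) :
    polCoord i (polConj x) = (starRingEnd ℂ) (polCoord i x) := by
  fin_cases i <;> simp [polCoord, polConj, map_ofNat] <;> ring

/-- The polarisation of a real power series on `ℂ²`. -/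
def polSeries (p : FormalMultilinearSeries ℝ C2 ℝ) : FormalMultilinearSeries ℂ PolSpace ℂ :=
  fun n => ∑ i : Fin n → Fin 4, ((p n fun j => realBasisVec (i j) : ℝ) : ℂ) •
    (ContinuousMultilinearMap.mkPiAlgebra ℂ (Fin n) ℂ).compContinuousLinearMap
      fun j => polCoord (i j)

theorem polSeries_apply_diag (p : FormalMultilinearSeries ℝ C2 ℝ) (n : ℕ) (x : PolSpace) :
    polSeries p n (fun _ => x) = ∑ i : Fin n → Fin 4,
      ((p n fun j => realBasisVec (i j) : ℝ) : ℂ) * ∏ j, polCoord (i j) x := by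
  simp [polSeries]

theorem polSeries_polEmb (p : FormalMultilinearSeries ℝ C2 ℝ) (n : ℕ) (x : C2) :
    polSeries p n (fun _ => polEmb x) = (p n fun _ => x : ℝ) := by
  rw [polSeries_apply_diag]
  conv_rhs => rw [← sum_realCoord x]
  rw [ContinuousMultilinearMap.map_sum]
  push_cast
  refine Finset.sum_congr rfl fun i _ => ?_
  rw [ContinuousMultilinearMap.map_smul_univ]
  simp only [polCoord_polEmb, smul_eq_mul]
  push_cast
  ring

theorem polSeries_polConj (p : FormalMultilinearSeries ℝ C2 ℝ) (n : ℕ) (x : PolSpace) :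
    polSeries p n (fun _ => polConj x) = (starRingEnd ℂ) (polSeries p n (fun _ => x)) := by
  simp [polSeries_apply_diag, polCoord_polConj]

theorem polSeries_radius_pos {p : FormalMultilinearSeries ℝ C2 ℝ} (hp : 0 < p.radius) :
    0 < (polSeries p).radius := by
  obtain ⟨C, r, hC, hr, hpn⟩ := p.le_mul_pow_of_radius_pos hp
  set K : ℝ := ∑ i, ‖polCoord i‖ with hK
  have hKi : ∀ i, ‖polCoord i‖ ≤ K := fun i =>
    Finset.single_le_sum (f := fun i => ‖polCoord i‖) (fun _ _ => norm_nonneg _)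
      (Finset.mem_univ i)
  have hK0 : 0 ≤ K := (norm_nonneg _).trans (hKi 0)
  have hb : ∀ n, ‖polSeries p n‖ ≤ C * (4 * r * (K + 1)) ^ n := by
    intro n
    have : ∀ i : Fin n → Fin 4, ‖((p n fun j => realBasisVec (i j) : ℝ) : ℂ) •
        (ContinuousMultilinearMap.mkPiAlgebra ℂ (Fin n) ℂ).compContinuousLinearMap
        fun j => polCoord (i j)‖ ≤ C * r ^ n * (K + 1) ^ n := by
      intro i
      rw [norm_smul, norm_real]
      have h1 : ‖p n fun j => realBasisVec (i j)‖ ≤ C * r ^ n := by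
        refine ((p n).le_opNorm _).trans ?_
        refine (mul_le_of_le_one_right (norm_nonneg _) ?_).trans (hpn n)
        exact Finset.prod_le_one (fun _ _ => norm_nonneg _) fun j _ => norm_realBasisVec _
      have h2 : ‖(ContinuousMultilinearMap.mkPiAlgebra ℂ (Fin n) ℂ).compContinuousLinearMap
          fun j => polCoord (i j)‖ ≤ (K + 1) ^ n := by
        refine (ContinuousMultilinearMap.norm_compContinuousLinearMap_le _ _).trans ?_
        rw [ContinuousMultilinearMap.norm_mkPiAlgebra, one_mul]
        calc ∏ j, ‖polCoord (i j)‖ ≤ ∏ _j : Fin n, (K + 1) :=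
              Finset.prod_le_prod (fun _ _ => norm_nonneg _) fun j _ => (hKi _).trans (by linarith)
          _ = (K + 1) ^ n := by simp
      gcongr
    refine (norm_sum_le _ _).trans ((Finset.sum_le_sum fun i _ => this i).trans ?_)
    simp only [Finset.sum_const, Finset.card_univ, Fintype.card_fun, Fintype.card_fin, nsmul_eq_mul]
    push_cast
    apply le_of_eq
    simp only [mul_pow]
    ring
  have hpos : 0 < 4 * r * (K + 1) := by positivity
  refine lt_of_lt_of_le ?_ ((polSeries p).le_radius_of_bound (r := ⟨(4 * r * (K + 1))⁻¹,
    by positivity⟩) C fun n => ?_)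
  · exact ENNReal.coe_pos.2 (inv_pos.2 hpos)
  · change _ * ((4 * r * (K + 1))⁻¹) ^ n ≤ C
    rw [inv_pow, ← div_eq_mul_inv, div_le_iff₀ (by positivity)]
    exact hb n

theorem polEmb_sub (x y : C2) : polEmb (x - y) = polEmb x - polEmb y := by
  simp [polEmb]

theorem polConj_sub (x y : PolSpace) : polConj (x - y) = polConj x - polConj y := by
  simp [polConj]

theorem polConj_polEmb (x : C2) : polConj (polEmb x) = polEmb x := by
  simp [polConj, polEmb]

theorem continuous_polEmb : Continuous polEmb := by
  have := Complex.continuous_conj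
  unfold polEmb
  fun_prop

/-- Polarisation of a real analytic function. -/
theorem exists_polarization {r : C2 → ℝ} {p : C2} (hr : AnalyticAt ℝ r p) :
    ∃ R : PolSpace → ℂ, AnalyticAt ℂ R (polEmb p) ∧ (∀ᶠ x in 𝓝 p, R (polEmb x) = r x) ∧
      ∀ x, R (polConj x) = (starRingEnd ℂ) (R x) := by
  obtain ⟨P, hP⟩ := hr
  obtain ⟨ρ, hρ⟩ := hP
  have hrad := polSeries_radius_pos (hρ.r_pos.trans_le hρ.r_le)
  refine ⟨fun x => (polSeries P).sum (x - polEmb p), ?_, ?_, ?_⟩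
  · have := ((polSeries P).hasFPowerSeriesOnBall hrad).comp_sub (polEmb p)
    rw [zero_add] at this
    exact this.analyticAt
  · have h1 : ∀ᶠ x in 𝓝 p, x ∈ Metric.eball p ρ := Metric.eball_mem_nhds _ hρ.r_pos
    filter_upwards [h1] with x hx
    have hs := hρ.hasSum_sub hx
    rw [FormalMultilinearSeries.sum, ← polEmb_sub]
    simp only [polSeries_polEmb]
    rw [← Complex.ofReal_tsum, hs.tsum_eq]
  · intro x
    have h : polConj x - polEmb p = polConj (x - polEmb p) := by
      rw [polConj_sub, polConj_polEmb]
    simp only [h, FormalMultilinearSeries.sum, polSeries_polConj]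
    exact (Complex.conj_tsum _).symm

theorem isInvertible_of_apply_one_ne_zero {L : ℂ →L[ℂ] ℂ} (h : L 1 ≠ 0) : L.IsInvertible :=
  ⟨ContinuousLinearEquiv.unitsEquivAut ℂ (Units.mk0 _ h), by ext; simp⟩

theorem polEmb_add_smul (p v : C2) (t : ℝ) :
    polEmb (p + t • v) = polEmb p + (t : ℂ) • polEmb v := by
  simp [polEmb]

theorem fderiv_polarization_apply {r : C2 → ℝ} {R : PolSpace → ℂ} {p : C2}
    (hr : AnalyticAt ℝ r p) (hR : AnalyticAt ℂ R (polEmb p))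
    (h : ∀ᶠ x in 𝓝 p, R (polEmb x) = r x) (v : C2) :
    fderiv ℂ R (polEmb p) (polEmb v) = (fderiv ℝ r p v : ℝ) := by
  have hl : HasDerivAt (fun t : ℝ => p + t • v) v 0 := by
    simpa using ((hasDerivAt_id (0 : ℝ)).smul_const v).const_add p
  have h1 : HasDerivAt (fun t : ℝ => r (p + t • v)) (fderiv ℝ r p v) 0 := by
    have := hr.differentiableAt.hasFDerivAt
    rw [show p = p + (0 : ℝ) • v by simp] at this
    simpa [Function.comp_def] using this.comp_hasDerivAt (0 : ℝ) hl
  have h2 : HasDerivAt (fun t : ℂ => R (polEmb p + t • polEmb v))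
      (fderiv ℂ R (polEmb p) (polEmb v)) 0 := by
    have hl' : HasDerivAt (fun t : ℂ => polEmb p + t • polEmb v) (polEmb v) 0 := by
      simpa using ((hasDerivAt_id (0 : ℂ)).smul_const (polEmb v)).const_add (polEmb p)
    have := hR.differentiableAt.hasFDerivAt
    rw [show polEmb p = polEmb p + (0 : ℂ) • polEmb v by simp] at this
    simpa [Function.comp_def] using this.comp_hasDerivAt (0 : ℂ) hl'
  have h3 := HasDerivAt.comp_ofReal (z := 0) (by simpa using h2)
  refine h3.unique (h1.ofReal_comp.congr_of_eventuallyEq ?_)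
  have hc : Tendsto (fun t : ℝ => p + t • v) (𝓝 0) (𝓝 p) := by
    simpa using hl.continuousAt.tendsto
  filter_upwards [hc.eventually h] with t ht
  rw [← polEmb_add_smul, ht]

/-- Local graph description `w̄ = S(z, w, z̄)` of a real analytic hypersurface, with the reality
condition satisfied by the complexified defining function. -/
theorem exists_segre {r : C2 → ℝ} {p : C2} (hr : AnalyticAt ℝ r p) (hp : r p = 0)
    {w₀ : ℂ} (hw : fderiv ℝ r p (0, w₀) ≠ 0) :
    ∃ S : C2 × ℂ → ℂ, AnalyticAt ℂ S (p, (starRingEnd ℂ) p.1) ∧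
      S (p, (starRingEnd ℂ) p.1) = (starRingEnd ℂ) p.2 ∧
      (∀ᶠ x in 𝓝 p, r x = 0 ↔ (starRingEnd ℂ) x.2 = S (x, (starRingEnd ℂ) x.1)) ∧
      ∀ᶠ y in 𝓝 (p, (starRingEnd ℂ) p.1),
        (starRingEnd ℂ) (S (((starRingEnd ℂ) y.2, (starRingEnd ℂ) (S y)),
          (starRingEnd ℂ) y.1.1)) = y.1.2 := by
  obtain ⟨R, hR, hRr, hconj⟩ := exists_polarization hr
  have hne : fderiv ℂ R (polEmb p) ((0 : C2 × ℂ), (1 : ℂ)) ≠ 0 := by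
    intro h0
    set R' := fderiv ℂ R (polEmb p)
    have key (w : ℂ) : w * R' (((0, 1), 0), 0) = (fderiv ℝ r p (0, w) : ℝ) := by
      rw [← fderiv_polarization_apply hr hR hRr]
      have : polEmb (0, w) = w • (((0, 1), 0), 0) + (starRingEnd ℂ) w • ((0 : C2 × ℂ), (1 : ℂ)) := by
        simp [polEmb]
      change _ = R' _
      rw [this, map_add, map_smul, map_smul, h0]
      simp
    have k1 := congrArg Complex.im (key 1)
    have k2 := congrArg Complex.im (key I)
    simp at k1 k2
    have : R' (((0, 1), 0), 0) = 0 := Complex.ext k2 k1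
    have k3 := key w₀
    rw [this, mul_zero] at k3
    exact hw (by exact_mod_cast k3.symm)
  have cdf : ContDiffAt ℂ ⊤ R (polEmb p) := hR.contDiffAt
  have pn : (⊤ : WithTop ℕ∞) ≠ 0 := by simp
  have hinv : (fderiv ℂ R (polEmb p) ∘L .inr ℂ (C2 × ℂ) ℂ).IsInvertible :=
    isInvertible_of_apply_one_ne_zero (by simpa using hne)
  set S := cdf.implicitFunction pn hinv with hS
  have hRp : R (polEmb p) = 0 := by rw [hRr.self_of_nhds, hp]; simp
  have hSan : AnalyticAt ℂ S (p, (starRingEnd ℂ) p.1) :=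
    (cdf.contDiffAt_implicitFunction pn hinv).analyticAt
  have hS0 : S (p, (starRingEnd ℂ) p.1) = (starRingEnd ℂ) p.2 :=
    cdf.implicitFunction_apply_self pn hinv
  have hiff := cdf.eventually_apply_eq_iff_implicitFunction pn hinv
  rw [hRp] at hiff
  have hpc : Continuous polConj := by unfold polConj; fun_prop
  refine ⟨S, hSan, hS0, ?_, ?_⟩
  · filter_upwards [hRr, continuous_polEmb.continuousAt.eventually hiff] with x h1 h2
    rw [h1] at h2
    rw [eq_comm (a := (starRingEnd ℂ) x.2)]
    exact Iff.trans (by simp) h2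
  · have hc : Tendsto (fun y => (y, S y)) (𝓝 (p, (starRingEnd ℂ) p.1)) (𝓝 (polEmb p)) := by
      have := (continuousAt_id.prodMk hSan.continuousAt).tendsto
      rw [hS0] at this
      exact this
    have hc' : Tendsto polConj (𝓝 (polEmb p)) (𝓝 (polEmb p)) := by
      simpa [polConj_polEmb] using hpc.tendsto (polEmb p)
    filter_upwards [hc.eventually hiff, (hc'.comp hc).eventually hiff] with y h1 h2
    have h3 : R (y, S y) = 0 := h1.2 rfl
    have h4 := h2.1 (by simp [hconj, h3])
    simp only [Function.comp, polConj] at h4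
    rw [← hS] at h4
    rw [h4]; simp

theorem taylor_one_bound {E : Type*} [NormedAddCommGroup E] [NormedSpace ℂ E] {F : E → ℂ} {P : E}
    (hF : AnalyticAt ℂ F P) : ∃ K : ℝ, 0 ≤ K ∧ ∃ δ > 0, ∀ Y : E, ‖Y‖ < δ →
      ‖F (P + Y) - F P - fderiv ℂ F P Y‖ ≤ K * ‖Y‖ ^ 2 := by
  obtain ⟨q, hq⟩ := hF
  obtain ⟨K, hK, h⟩ := (hq.isBigO_sub_partialSum_pow 2).exists_nonneg
  obtain ⟨δ, hδ, h⟩ := Metric.eventually_nhds_iff.1 h.bound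
  refine ⟨K, hK, δ, hδ, fun Y hY => ?_⟩
  have := h (y := Y) (by simpa using hY)
  have h1 : q.partialSum 2 Y = F P + fderiv ℂ F P Y := by
    rw [FormalMultilinearSeries.partialSum, Finset.sum_range_succ, Finset.sum_range_one, hq.fderiv_eq]
    rw [hq.coeff_zero]
    simp
    congr 1
    ext i; simp
  rw [h1] at this
  simpa [sub_sub] using this

theorem taylor_two_bound {E : Type*} [NormedAddCommGroup E] [NormedSpace ℂ E] {F : E → ℂ} {P : E}
    (hF : AnalyticAt ℂ F P) : ∃ K : ℝ, 0 ≤ K ∧ ∃ δ > 0, ∀ Y : E, ‖Y‖ < δ →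
      ‖F (P + Y) - F P - fderiv ℂ F P Y - 1 / 2 * fderiv ℂ (fderiv ℂ F) P Y Y‖ ≤ K * ‖Y‖ ^ 3 := by
  obtain ⟨q, hq⟩ := hF
  obtain ⟨K, hK, h⟩ := (hq.isBigO_sub_partialSum_pow 3).exists_nonneg
  obtain ⟨δ, hδ, h⟩ := Metric.eventually_nhds_iff.1 h.bound
  refine ⟨K, hK, δ, hδ, fun Y hY => ?_⟩
  have := h (y := Y) (by simpa using hY)
  have h1 : q.partialSum 3 Y = F P + fderiv ℂ F P Y + 1 / 2 * fderiv ℂ (fderiv ℂ F) P Y Y := by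
    rw [FormalMultilinearSeries.partialSum, Finset.sum_range_succ, Finset.sum_range_succ,
      Finset.sum_range_one, hq.fderiv_eq]
    rw [hq.coeff_zero]
    obtain ⟨r, hr⟩ := hq
    have h2 := hr.factorial_smul Y 2
    rw [iteratedFDeriv_two_apply] at h2
    simp only [Nat.factorial, nsmul_eq_mul] at h2
    rw [← h2]
    simp
    congr 1
    ext i; simp
  rw [h1] at this
  simpa [sub_sub, add_assoc] using this

theorem norm_dir_le {E : Type*} [NormedAddCommGroup E] [NormedSpace ℂ E] (A B N : E) (s τ : ℂ) :
    ‖s • A + (starRingEnd ℂ) s • B + τ • N‖ ≤ (‖A‖ + ‖B‖ + ‖N‖) * (‖s‖ + ‖τ‖) := by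
  refine (norm_add₃_le).trans ?_
  simp only [norm_smul, RCLike.norm_conj]
  nlinarith [norm_nonneg A, norm_nonneg B, norm_nonneg N, norm_nonneg s, norm_nonneg τ,
    mul_nonneg (norm_nonneg A) (norm_nonneg τ), mul_nonneg (norm_nonneg B) (norm_nonneg τ),
    mul_nonneg (norm_nonneg N) (norm_nonneg s)]

theorem exists_dir_small {E : Type*} [NormedAddCommGroup E] [NormedSpace ℂ E] (A B N : E)
    {δ : ℝ} (hδ : 0 < δ) : ∃ η > 0, ∀ s τ : ℂ, ‖s‖ < η → ‖τ‖ < η →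
      ‖s • A + (starRingEnd ℂ) s • B + τ • N‖ < δ := by
  have hM : 0 ≤ ‖A‖ + ‖B‖ + ‖N‖ := by positivity
  set M := ‖A‖ + ‖B‖ + ‖N‖
  refine ⟨δ / (2 * (M + 1)), by positivity, fun s τ hs hτ => ?_⟩
  rw [lt_div_iff₀ (by positivity)] at hs hτ
  refine (norm_dir_le A B N s τ).trans_lt ?_
  change M * _ < δ
  nlinarith [norm_nonneg s, norm_nonneg τ]

theorem taylor_one_dir {E : Type*} [NormedAddCommGroup E] [NormedSpace ℂ E] {F : E → ℂ} {P : E}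
    (hF : AnalyticAt ℂ F P) (A B N : E) : ∃ K : ℝ, 0 ≤ K ∧ ∃ δ > 0, ∀ s τ : ℂ, ‖s‖ < δ → ‖τ‖ < δ →
      ‖F (P + (s • A + (starRingEnd ℂ) s • B + τ • N)) - F P -
        (s * fderiv ℂ F P A + (starRingEnd ℂ) s * fderiv ℂ F P B)‖ ≤
        K * (‖τ‖ + (‖s‖ + ‖τ‖) ^ 2) := by
  obtain ⟨K, hK, δ, hδ, h⟩ := taylor_one_bound hF
  obtain ⟨η, hη, h'⟩ := exists_dir_small A B N hδ
  have hM : 0 ≤ ‖A‖ + ‖B‖ + ‖N‖ := by positivity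
  set M := ‖A‖ + ‖B‖ + ‖N‖ with hMdef
  refine ⟨K * M ^ 2 + ‖fderiv ℂ F P N‖, by positivity, η, hη, fun s τ hs hτ => ?_⟩
  have h1 := h _ (h' s τ hs hτ)
  have h2 := norm_dir_le A B N s τ
  rw [← hMdef] at h2
  set Y := s • A + (starRingEnd ℂ) s • B + τ • N with hY
  have h3 : F (P + Y) - F P - (s * fderiv ℂ F P A + (starRingEnd ℂ) s * fderiv ℂ F P B) =
      (F (P + Y) - F P - fderiv ℂ F P Y) + τ * fderiv ℂ F P N := by
    rw [hY]; simp only [map_add, map_smul, smul_eq_mul]; ring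
  rw [h3]
  refine (norm_add_le _ _).trans ?_
  rw [norm_mul]
  have h4 : ‖Y‖ ^ 2 ≤ (M * (‖s‖ + ‖τ‖)) ^ 2 := by gcongr
  have h5 := mul_le_mul_of_nonneg_left h4 hK
  have : 0 ≤ K * M ^ 2 * ‖τ‖ := by positivity
  have : 0 ≤ ‖fderiv ℂ F P N‖ * (‖s‖ + ‖τ‖) ^ 2 := by positivity
  nlinarith

theorem taylor_two_dir {E : Type*} [NormedAddCommGroup E] [NormedSpace ℂ E] {F : E → ℂ} {P : E}
    (hF : AnalyticAt ℂ F P) (A B N : E) : ∃ K : ℝ, 0 ≤ K ∧ ∃ δ > 0, ∀ s τ : ℂ, ‖s‖ < δ → ‖τ‖ < δ →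
      ‖F (P + (s • A + (starRingEnd ℂ) s • B + τ • N)) - F P -
        (s * fderiv ℂ F P A + (starRingEnd ℂ) s * fderiv ℂ F P B + τ * fderiv ℂ F P N) -
        (1 / 2 * s ^ 2 * fderiv ℂ (fderiv ℂ F) P A A +
          1 / 2 * (starRingEnd ℂ) s ^ 2 * fderiv ℂ (fderiv ℂ F) P B B +
          s * (starRingEnd ℂ) s * fderiv ℂ (fderiv ℂ F) P A B)‖ ≤
        K * (‖τ‖ * (‖s‖ + ‖τ‖) + (‖s‖ + ‖τ‖) ^ 3) := by
  have hsym : ∀ X Y, fderiv ℂ (fderiv ℂ F) P X Y = fderiv ℂ (fderiv ℂ F) P Y X := by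
    have h1 : ContDiffAt ℂ ⊤ F P := hF.contDiffAt
    exact h1.isSymmSndFDerivAt (by simp)
  obtain ⟨K, hK, δ, hδ, h⟩ := taylor_two_bound hF
  obtain ⟨η, hη, h'⟩ := exists_dir_small A B N hδ
  have hM : 0 ≤ ‖A‖ + ‖B‖ + ‖N‖ := by positivity
  set M := ‖A‖ + ‖B‖ + ‖N‖ with hMdef
  set T := fderiv ℂ (fderiv ℂ F) P with hT
  refine ⟨K * M ^ 3 + (‖T N N‖ + ‖T A N‖ + ‖T B N‖), by positivity, η, hη, fun s τ hs hτ => ?_⟩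
  have h1 := h _ (h' s τ hs hτ)
  have h2 := norm_dir_le A B N s τ
  rw [← hMdef] at h2
  set Y := s • A + (starRingEnd ℂ) s • B + τ • N with hY
  have h3 : F (P + Y) - F P -
        (s * fderiv ℂ F P A + (starRingEnd ℂ) s * fderiv ℂ F P B + τ * fderiv ℂ F P N) -
        (1 / 2 * s ^ 2 * T A A + 1 / 2 * (starRingEnd ℂ) s ^ 2 * T B B +
          s * (starRingEnd ℂ) s * T A B) =
      (F (P + Y) - F P - fderiv ℂ F P Y - 1 / 2 * T Y Y) +
        τ * (1 / 2 * τ * T N N + s * T A N + (starRingEnd ℂ) s * T B N) := by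
    rw [hY]
    simp only [map_add, map_smul, smul_eq_mul, _root_.add_apply, _root_.smul_apply]
    rw [hsym B A, hsym N A, hsym N B]
    ring
  rw [h3]
  refine (norm_add_le _ _).trans ?_
  rw [norm_mul]
  have h4 : ‖Y‖ ^ 3 ≤ (M * (‖s‖ + ‖τ‖)) ^ 3 := by gcongr
  have h5 := mul_le_mul_of_nonneg_left h4 hK
  have h6 : ‖1 / 2 * τ * T N N + s * T A N + (starRingEnd ℂ) s * T B N‖ ≤
      (‖T N N‖ + ‖T A N‖ + ‖T B N‖) * (‖s‖ + ‖τ‖) := by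
    refine norm_add₃_le.trans ?_
    simp only [norm_mul, RCLike.norm_conj]
    norm_num
    nlinarith [norm_nonneg s, norm_nonneg τ, norm_nonneg (T N N), norm_nonneg (T A N),
      norm_nonneg (T B N), mul_nonneg (norm_nonneg (T N N)) (norm_nonneg s),
      mul_nonneg (norm_nonneg (T N N)) (norm_nonneg τ),
      mul_nonneg (norm_nonneg (T A N)) (norm_nonneg τ),
      mul_nonneg (norm_nonneg (T B N)) (norm_nonneg τ)]
  have h7 := mul_le_mul_of_nonneg_left h6 (norm_nonneg τ)
  have : 0 ≤ K * M ^ 3 * (‖τ‖ * (‖s‖ + ‖τ‖)) := by positivity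
  have : 0 ≤ (‖T N N‖ + ‖T A N‖ + ‖T B N‖) * (‖s‖ + ‖τ‖) ^ 3 := by positivity
  nlinarith

/-- At `q` there is no holomorphic change of coordinates in which `L` lies strictly on one side of
a strictly pseudoconvex quadric. -/
def NoPeakAt (L : Set C2) (q : C2) : Prop :=
  ∀ Φ : C2 ≃ₜ C2, Differentiable ℂ Φ → Φ 0 = q → ∀ α C δ : ℝ, 0 < α → 0 ≤ C → 0 < δ →
    ¬ ∀ x : C2, x ≠ 0 → ‖x‖ < δ → Φ x ∈ L → x.2.re + α * ‖x.1‖ ^ 2 - C * ‖x.2‖ ^ 2 < 0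

/-- The quadratic change of coordinates `(s, t) ↦ q + s (1, a) + (t - β s²) / μ (0, 1)`. -/
def quadraticHomeomorph (q : C2) (a β μ : ℂ) (hμ : μ ≠ 0) : C2 ≃ₜ C2 where
  toFun x := (q.1 + x.1, q.2 + a * x.1 + (x.2 - β * x.1 ^ 2) / μ)
  invFun y := (y.1 - q.1, μ * (y.2 - q.2 - a * (y.1 - q.1)) + β * (y.1 - q.1) ^ 2)
  left_inv x := by
    ext
    · simp
    · simp only [add_sub_cancel_left]
      field_simp
      ring
  right_inv y := by
    ext
    · simp
    · field_simp
      ring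
  continuous_toFun := by fun_prop
  continuous_invFun := by fun_prop

theorem error_bound {n m ν k K₁ K₂ : ℝ} (hn : 0 ≤ n) (hm : 0 ≤ m) (hn1 : n ≤ 1) (hm1 : m ≤ 1)
    (hν : 0 ≤ ν) (hk : 1 ≤ k) (hK₁ : 0 ≤ K₁) (h1 : ν ≤ k * (m + n ^ 2))
    (h2 : n + ν ≤ k * (n + m)) :
    K₁ * (ν * (n + ν) + (n + ν) ^ 3) + (K₂ * (ν + (n + ν) ^ 2)) ^ 2 ≤
      (K₁ * (2 * k ^ 2 + 4 * k ^ 3) + K₂ ^ 2 * (18 * k ^ 4)) * (m * n + m ^ 2 + n ^ 3) := by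
  have hmn : 0 ≤ m * n := mul_nonneg hm hn
  have hn2 : n ^ 2 ≤ n := by nlinarith
  have hm2 : m ^ 2 ≤ m := by nlinarith
  have hm3 : m ^ 3 ≤ m ^ 2 := by nlinarith [sq_nonneg m]
  have hmn2 : m * n ^ 2 ≤ m * n := mul_le_mul_of_nonneg_left hn2 hm
  have hn4 : n ^ 4 ≤ n ^ 3 := by nlinarith [pow_nonneg hn 3]
  have e1 : ν * (n + ν) ≤ 2 * k ^ 2 * (m * n + m ^ 2 + n ^ 3) := by
    calc ν * (n + ν) ≤ (k * (m + n ^ 2)) * (k * (n + m)) := by gcongr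
      _ = k ^ 2 * (m * n + m ^ 2 + n ^ 3 + m * n ^ 2) := by ring
      _ ≤ k ^ 2 * (2 * (m * n + m ^ 2 + n ^ 3)) := by
        gcongr
        nlinarith [pow_nonneg hn 3, sq_nonneg m]
      _ = _ := by ring
  have e2 : (n + ν) ^ 3 ≤ 4 * k ^ 3 * (m * n + m ^ 2 + n ^ 3) := by
    calc (n + ν) ^ 3 ≤ (k * (n + m)) ^ 3 := by gcongr
      _ = k ^ 3 * (n + m) ^ 3 := by ring
      _ ≤ k ^ 3 * (4 * (m * n + m ^ 2 + n ^ 3)) := by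
        gcongr
        nlinarith [mul_nonneg (add_nonneg hn hm) (sq_nonneg (n - m))]
      _ = _ := by ring
  have e3 : (ν + (n + ν) ^ 2) ^ 2 ≤ 18 * k ^ 4 * (m * n + m ^ 2 + n ^ 3) := by
    have hb : ν + (n + ν) ^ 2 ≤ k ^ 2 * (3 * (m + n ^ 2)) := by
      calc ν + (n + ν) ^ 2 ≤ k * (m + n ^ 2) + (k * (n + m)) ^ 2 := by gcongr
        _ ≤ k ^ 2 * (m + n ^ 2) + (k * (n + m)) ^ 2 := by
          gcongr
          nlinarith
        _ = k ^ 2 * (m + n ^ 2 + (n + m) ^ 2) := by ring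
        _ ≤ _ := by
          gcongr
          nlinarith [sq_nonneg (n - m)]
    calc (ν + (n + ν) ^ 2) ^ 2 ≤ (k ^ 2 * (3 * (m + n ^ 2))) ^ 2 := by gcongr
      _ = k ^ 4 * (9 * (m ^ 2 + 2 * (m * n ^ 2) + n ^ 4)) := by ring
      _ ≤ k ^ 4 * (18 * (m * n + m ^ 2 + n ^ 3)) := by
        refine mul_le_mul_of_nonneg_left ?_ (by positivity)
        nlinarith [pow_nonneg hn 3, sq_nonneg m]
      _ = _ := by ring
  calc _ = K₁ * (ν * (n + ν) + (n + ν) ^ 3) + K₂ ^ 2 * (ν + (n + ν) ^ 2) ^ 2 := by ring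
    _ ≤ K₁ * (2 * k ^ 2 * (m * n + m ^ 2 + n ^ 3) + 4 * k ^ 3 * (m * n + m ^ 2 + n ^ 3)) +
        K₂ ^ 2 * (18 * k ^ 4 * (m * n + m ^ 2 + n ^ 3)) := by gcongr
    _ = _ := by ring

theorem neg_of_le_error {α K n m x : ℝ} (hα : 0 < α) (hnm : 0 < n ∨ 0 < m) (hsmall : K * n ≤ α / 4)
    (h : x + α * n ^ 2 ≤ K * (m * n + m ^ 2 + n ^ 3)) :
    x + α / 4 * n ^ 2 - (K + K ^ 2 / α + 1) * m ^ 2 < 0 := by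
  have h1 : K * (m * n) ≤ α / 4 * n ^ 2 + K ^ 2 / α * m ^ 2 := by
    have : 0 ≤ (α / 2 * n - K * m) ^ 2 / α := by positivity
    have e : (α / 2 * n - K * m) ^ 2 / α = α / 4 * n ^ 2 + K ^ 2 / α * m ^ 2 - K * (m * n) := by
      field_simp; ring
    linarith
  have h2 : K * n ^ 3 ≤ α / 4 * n ^ 2 := by nlinarith [sq_nonneg n]
  have h3 : 0 < α / 4 * n ^ 2 + m ^ 2 := by rcases hnm with h | h <;> positivity
  nlinarith

theorem normSq_mixed (s P Q : ℂ) : ‖s * P + (starRingEnd ℂ) s * Q‖ ^ 2 =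
    (‖P‖ ^ 2 + ‖Q‖ ^ 2) * ‖s‖ ^ 2 + (2 * P * (starRingEnd ℂ) Q * s ^ 2).re := by
  simp only [Complex.sq_norm, Complex.normSq_apply]
  simp [pow_two]
  ring

theorem re_mixed (c s T₁ T₂ T₃ : ℂ) :
    (c * (1 / 2 * s ^ 2 * T₁ + 1 / 2 * (starRingEnd ℂ) s ^ 2 * T₂ +
      s * (starRingEnd ℂ) s * T₃)).re =
    (1 / 2 * (c * T₁ + (starRingEnd ℂ) (c * T₂)) * s ^ 2).re + (c * T₃).re * ‖s‖ ^ 2 := by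
  simp only [Complex.sq_norm, Complex.normSq_apply]
  simp [pow_two]
  ring

theorem re_linear_part (c z τ s a Sw Z u : ℂ) (h : z = u + a * s) :
    (((starRingEnd ℂ) c - c * Sw) * τ).re - (c * Z).re =
      (c * ((starRingEnd ℂ) (z + τ) - (starRingEnd ℂ) u -
        (s * 0 + (starRingEnd ℂ) s * (starRingEnd ℂ) a + τ * Sw) - Z)).re := by
  subst h
  simp
  ring

theorem quadratic_shift_bound (s t β μ : ℂ) (hs : ‖s‖ ≤ 1) :
    ‖(t - β * s ^ 2) / μ‖ ≤ (1 + (1 + ‖β‖) / ‖μ‖) * (‖t‖ + ‖s‖ ^ 2) ∧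
      ‖s‖ + ‖(t - β * s ^ 2) / μ‖ ≤ (1 + (1 + ‖β‖) / ‖μ‖) * (‖s‖ + ‖t‖) := by
  have h0 : ‖(t - β * s ^ 2) / μ‖ ≤ (‖t‖ + ‖β‖ * ‖s‖ ^ 2) / ‖μ‖ := by
    rw [norm_div]
    gcongr
    refine (norm_sub_le _ _).trans ?_
    rw [norm_mul, norm_pow]
  have hβt := mul_nonneg (norm_nonneg β) (norm_nonneg t)
  constructor
  · have h' : (‖t‖ + ‖β‖ * ‖s‖ ^ 2) / ‖μ‖ ≤ (1 + ‖β‖) * (‖t‖ + ‖s‖ ^ 2) / ‖μ‖ := by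
      gcongr
      nlinarith [sq_nonneg ‖s‖]
    have : 0 ≤ 1 * (‖t‖ + ‖s‖ ^ 2) := by positivity
    rw [add_mul, div_mul_eq_mul_div]
    linarith
  · have h' : (‖t‖ + ‖β‖ * ‖s‖ ^ 2) / ‖μ‖ ≤ (1 + ‖β‖) * (‖s‖ + ‖t‖) / ‖μ‖ := by
      gcongr
      have : ‖s‖ ^ 2 ≤ ‖s‖ := by nlinarith [norm_nonneg s]
      nlinarith [norm_nonneg s, mul_le_mul_of_nonneg_left this (norm_nonneg β)]
    rw [add_mul, div_mul_eq_mul_div]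
    linarith [norm_nonneg t]

theorem NoPeakAt.levi_le {L : Set C2} {q : C2} (hL : NoPeakAt L q) (hqL : q ∈ L)
    {S H : C2 × ℂ → ℂ} (hS : AnalyticAt ℂ S (q, (starRingEnd ℂ) q.1))
    (hH : AnalyticAt ℂ H (q, (starRingEnd ℂ) q.1))
    (hLS : ∀ᶠ x in 𝓝 q, x ∈ L → (starRingEnd ℂ) x.2 = S (x, (starRingEnd ℂ) x.1))
    (hLH : ∀ᶠ x in 𝓝 q, x ∈ L → H (x, (starRingEnd ℂ) x.1) = 0) {a : ℂ}
    (ha₁ : fderiv ℂ S (q, (starRingEnd ℂ) q.1) ((1, a), 0) = 0)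
    (ha₂ : fderiv ℂ S (q, (starRingEnd ℂ) q.1) ((0, 0), 1) = (starRingEnd ℂ) a) (c : ℂ)
    (hμ : (starRingEnd ℂ) c - c * fderiv ℂ S (q, (starRingEnd ℂ) q.1) ((0, 1), 0) ≠ 0) :
    -(c * fderiv ℂ (fderiv ℂ S) (q, (starRingEnd ℂ) q.1) ((1, a), 0) ((0, 0), 1)).re +
      (‖fderiv ℂ H (q, (starRingEnd ℂ) q.1) ((1, a), 0)‖ ^ 2 +
        ‖fderiv ℂ H (q, (starRingEnd ℂ) q.1) ((0, 0), 1)‖ ^ 2) ≤ 0 := by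
  by_contra! hα
  obtain ⟨K₁, hK₁, δ₁, hδ₁, hT₁⟩ := taylor_two_dir hS ((1, a), 0) ((0, 0), 1) ((0, 1), 0)
  obtain ⟨K₂, hK₂, δ₂, hδ₂, hT₂⟩ := taylor_one_dir hH ((1, a), 0) ((0, 0), 1) ((0, 1), 0)
  have hSq := hLS.self_of_nhds hqL
  have hHq := hLH.self_of_nhds hqL
  set P₀ : C2 × ℂ := (q, (starRingEnd ℂ) q.1) with hP₀
  set T := fderiv ℂ (fderiv ℂ S) P₀ with hT
  set P := fderiv ℂ H P₀ ((1, a), 0) with hP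
  set Q := fderiv ℂ H P₀ ((0, 0), 1) with hQ
  set Sw := fderiv ℂ S P₀ ((0, 1), 0) with hSw
  set μ := (starRingEnd ℂ) c - c * Sw with hμdef
  set α := -(c * T ((1, a), 0) ((0, 0), 1)).re + (‖P‖ ^ 2 + ‖Q‖ ^ 2) with hαdef
  set β := -(1 / 2 * (c * T ((1, a), 0) ((1, a), 0) +
    (starRingEnd ℂ) (c * T ((0, 0), 1) ((0, 0), 1)))) + 2 * P * (starRingEnd ℂ) Q with hβ
  set k := 1 + (1 + ‖β‖) / ‖μ‖ with hk
  have hk1 : 1 ≤ k := by simp only [hk, le_add_iff_nonneg_right]; positivity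
  set K := ‖c‖ * K₁ * (2 * k ^ 2 + 4 * k ^ 3) + K₂ ^ 2 * (18 * k ^ 4) with hKdef
  have hK0 : 0 ≤ K := by positivity
  set Φ := quadraticHomeomorph q a β μ hμ with hΦ
  have hΦ0 : Φ 0 = q := by simp [hΦ, quadraticHomeomorph]
  have hΦd : Differentiable ℂ Φ := by
    change Differentiable ℂ fun x : C2 => (q.1 + x.1, q.2 + a * x.1 + (x.2 - β * x.1 ^ 2) / μ)
    fun_prop (disch := exact hμ)
  have hc1 : Tendsto (fun x : C2 => ‖x.1‖) (𝓝 0) (𝓝 0) := by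
    have : Continuous fun x : C2 => ‖x.1‖ := by fun_prop
    simpa using this.tendsto 0
  have hc2 : Tendsto (fun x : C2 => ‖x.2‖) (𝓝 0) (𝓝 0) := by
    have : Continuous fun x : C2 => ‖x.2‖ := by fun_prop
    simpa using this.tendsto 0
  have hc3 : Tendsto (fun x : C2 => ‖(x.2 - β * x.1 ^ 2) / μ‖) (𝓝 0) (𝓝 0) := by
    have : Continuous fun x : C2 => ‖(x.2 - β * x.1 ^ 2) / μ‖ := by fun_prop
    simpa using this.tendsto 0
  have hc4 : Tendsto Φ (𝓝 0) (𝓝 q) := by simpa [hΦ0] using Φ.continuous.tendsto 0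
  have hev : ∀ᶠ x : C2 in 𝓝 0, x ≠ 0 → Φ x ∈ L →
      x.2.re + α / 4 * ‖x.1‖ ^ 2 - (K + K ^ 2 / α + 1) * ‖x.2‖ ^ 2 < 0 := by
    filter_upwards [hc4.eventually hLS, hc4.eventually hLH, hc1.eventually_lt_const hδ₁,
      hc1.eventually_lt_const hδ₂, hc3.eventually_lt_const hδ₁, hc3.eventually_lt_const hδ₂,
      hc1.eventually_lt_const one_pos, hc2.eventually_lt_const one_pos,
      hc1.eventually_lt_const (show 0 < α / 4 / (K + 1) by positivity)]
      with x h1 h2 h3 h4 h5 h6 h7 h8 h9 hx hxL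
    obtain ⟨s, t⟩ := x
    dsimp only at h3 h4 h5 h6 h7 h8 h9 ⊢
    set τ := (t - β * s ^ 2) / μ with hτ
    have hΦx : Φ (s, t) = (q.1 + s, q.2 + a * s + τ) := rfl
    have hY : ((Φ (s, t), (starRingEnd ℂ) (Φ (s, t)).1) : C2 × ℂ) =
        P₀ + (s • ((1, a), 0) + (starRingEnd ℂ) s • ((0, 0), 1) + τ • ((0, 1), 0)) := by
      rw [hΦx, hP₀]
      simp only [Prod.smul_mk, Prod.mk_add_mk, smul_eq_mul, map_add]
      refine Prod.ext (Prod.ext ?_ ?_) ?_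
      · simp
      · change q.2 + a * s + τ = q.2 + _
        simp
        ring
      · simp
    have e1 := h1 hxL
    have e2 := h2 hxL
    rw [hY] at e1 e2
    have b1 := hT₁ s τ h3 h5
    have b2 := hT₂ s τ h4 h6
    rw [← e1, ← hSq, ha₁, ha₂, hΦx] at b1
    rw [e2, hHq] at b2
    have hts : t = μ * τ + β * s ^ 2 := by rw [hτ]; field_simp; ring
    obtain ⟨hν, hν'⟩ := quadratic_shift_bound s t β μ h7.le
    rw [← hτ, ← hk] at hν hν'
    have c1 : (μ * τ).re - (c * (1 / 2 * s ^ 2 * T ((1, a), 0) ((1, a), 0) +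
        1 / 2 * (starRingEnd ℂ) s ^ 2 * T ((0, 0), 1) ((0, 0), 1) +
        s * (starRingEnd ℂ) s * T ((1, a), 0) ((0, 0), 1))).re ≤
        ‖c‖ * K₁ * (‖τ‖ * (‖s‖ + ‖τ‖) + (‖s‖ + ‖τ‖) ^ 3) := by
      rw [mul_assoc ‖c‖]
      refine le_trans ?_ (mul_le_mul_of_nonneg_left b1 (norm_nonneg c))
      rw [← norm_mul]
      refine le_trans (le_of_eq ?_) (Complex.re_le_norm _)
      rw [hμdef]
      exact re_linear_part c _ τ s a Sw _ _ rfl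
    have c2 : ‖s * P + (starRingEnd ℂ) s * Q‖ ^ 2 ≤
        (K₂ * (‖τ‖ + (‖s‖ + ‖τ‖) ^ 2)) ^ 2 := by
      gcongr
      rwa [sub_self, zero_sub, norm_neg] at b2
    rw [normSq_mixed] at c2
    rw [re_mixed] at c1
    have c3 := error_bound (K₂ := K₂) (norm_nonneg s) (norm_nonneg t) h7.le h8.le (norm_nonneg τ) hk1
      (mul_nonneg (norm_nonneg c) hK₁) hν hν'
    have c4 : t.re + α * ‖s‖ ^ 2 ≤ K * (‖t‖ * ‖s‖ + ‖t‖ ^ 2 + ‖s‖ ^ 3) := by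
      have : t.re = (μ * τ).re - (1 / 2 * (c * T ((1, a), 0) ((1, a), 0) +
          (starRingEnd ℂ) (c * T ((0, 0), 1) ((0, 0), 1))) * s ^ 2).re +
          (2 * P * (starRingEnd ℂ) Q * s ^ 2).re := by
        conv_lhs => rw [hts, hβ]
        rw [← Complex.sub_re, ← Complex.add_re]
        congr 1
        ring
      rw [this, hαdef]
      linarith
    refine neg_of_le_error hα ?_ ?_ c4
    · by_contra! h
      refine hx (Prod.ext ?_ ?_)
      · simpa using h.1
      · simpa using h.2
    · rw [lt_div_iff₀ (by positivity)] at h9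
      nlinarith [norm_nonneg s]
  obtain ⟨δ, hδ, hδ'⟩ := Metric.eventually_nhds_iff.1 hev
  exact hL Φ hΦd hΦ0 (α / 4) (K + K ^ 2 / α + 1) δ (by positivity) (by positivity) hδ
    fun x hx hxδ hxL => hδ' (by simpa using hxδ) hx hxL

theorem eventually_eq_zero_of_deriv_chain {k : ℕ → ℂ → ℂ} {c : ℂ} (h0 : AnalyticAt ℂ (k 0) c)
    (hd : ∀ m, deriv (k m) =ᶠ[𝓝 c] k (m + 1)) (hz : ∀ m, k m c = 0) : ∀ᶠ z in 𝓝 c, k 0 z = 0 := by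
  have hi : ∀ m, iteratedDeriv m (k 0) =ᶠ[𝓝 c] k m := by
    intro m
    induction m with
    | zero => simp [iteratedDeriv_zero]
    | succ m ih =>
      rw [iteratedDeriv_succ]
      exact ih.deriv.trans (hd m)
  have := h0.hasFPowerSeriesAt
  have hzero : (FormalMultilinearSeries.ofScalars ℂ
      (fun n ↦ iteratedDeriv n (k 0) c / n.factorial)) = 0 := by
    ext n
    simp [FormalMultilinearSeries.ofScalars, (hi n).self_of_nhds, hz]
  rw [hzero] at this
  exact this.eventually_eq_zero

/-- First order consequences of the reality of the defining equation `w̄ = S(z, w, z̄)`. -/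
theorem segre_fderiv {S : C2 × ℂ → ℂ} {x : C2}
    (hS : DifferentiableAt ℂ S (x, (starRingEnd ℂ) x.1))
    (hx : (starRingEnd ℂ) x.2 = S (x, (starRingEnd ℂ) x.1))
    (hrefl : ∀ᶠ y in 𝓝 (x, (starRingEnd ℂ) x.1),
      (starRingEnd ℂ) (S (((starRingEnd ℂ) y.2, (starRingEnd ℂ) (S y)),
        (starRingEnd ℂ) y.1.1)) = y.1.2) :
    fderiv ℂ S (x, (starRingEnd ℂ) x.1) ((0, 1), 0) ≠ 0 ∧
    fderiv ℂ S (x, (starRingEnd ℂ) x.1) ((1, 0), 0) +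
      (starRingEnd ℂ) (fderiv ℂ S (x, (starRingEnd ℂ) x.1) ((0, 0), 1)) *
        fderiv ℂ S (x, (starRingEnd ℂ) x.1) ((0, 1), 0) = 0 := by
  set P : C2 × ℂ := (x, (starRingEnd ℂ) x.1) with hP
  set S' := fderiv ℂ S P with hS'
  have hconj (v : C2 × ℂ) : (starRingEnd ℂ)
      (S' (((starRingEnd ℂ) v.2, (starRingEnd ℂ) (S' v)), (starRingEnd ℂ) v.1.1)) = v.1.2 := by
    have h1 : HasFDerivAt S (S'.restrictScalars ℝ) P := hS.hasFDerivAt.restrictScalars ℝ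
    have hl : HasDerivAt (fun t : ℝ => P + t • v) v 0 := by
      simpa using ((hasDerivAt_id (0 : ℝ)).smul_const v).const_add P
    have h2 : HasDerivAt (fun t : ℝ => S (P + t • v)) (S' v) 0 := by
      have h1' := h1
      rw [show P = P + (0 : ℝ) • v by simp] at h1'
      exact h1'.comp_hasDerivAt (0 : ℝ) hl
    have hc {g : ℝ → ℂ} {g' : ℂ} (h : HasDerivAt g g' 0) :
        HasDerivAt (fun t => (starRingEnd ℂ) (g t)) ((starRingEnd ℂ) g') 0 :=
      (Complex.conjCLE : ℂ →L[ℝ] ℂ).hasFDerivAt.comp_hasDerivAt (0 : ℝ) h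
    have hv2 : HasDerivAt (fun t : ℝ => (P + t • v).2) v.2 0 :=
      (ContinuousLinearMap.snd ℝ C2 ℂ).hasFDerivAt.comp_hasDerivAt (0 : ℝ) hl
    have hv1 : HasDerivAt (fun t : ℝ => (P + t • v).1) v.1 0 :=
      (ContinuousLinearMap.fst ℝ C2 ℂ).hasFDerivAt.comp_hasDerivAt (0 : ℝ) hl
    have hv11 : HasDerivAt (fun t : ℝ => (P + t • v).1.1) v.1.1 0 :=
      (ContinuousLinearMap.fst ℝ ℂ ℂ).hasFDerivAt.comp_hasDerivAt (0 : ℝ) hv1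
    have hv12 : HasDerivAt (fun t : ℝ => (P + t • v).1.2) v.1.2 0 :=
      (ContinuousLinearMap.snd ℝ ℂ ℂ).hasFDerivAt.comp_hasDerivAt (0 : ℝ) hv1
    have h3 := ((hc hv2).prodMk (hc h2)).prodMk (hc hv11)
    have h4 : (((starRingEnd ℂ) (P + (0 : ℝ) • v).2, (starRingEnd ℂ) (S (P + (0 : ℝ) • v))),
        (starRingEnd ℂ) (P + (0 : ℝ) • v).1.1) = P := by
      rw [zero_smul, add_zero, hP, ← hx]
      simp
    have h5 : HasFDerivAt S (S'.restrictScalars ℝ)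
        (((starRingEnd ℂ) (P + (0 : ℝ) • v).2, (starRingEnd ℂ) (S (P + (0 : ℝ) • v))),
        (starRingEnd ℂ) (P + (0 : ℝ) • v).1.1) := by rw [h4]; exact h1
    have h6 := hc (h5.comp_hasDerivAt (0 : ℝ) h3)
    refine h6.unique (hv12.congr_of_eventuallyEq ?_)
    have ht : Tendsto (fun t : ℝ => P + t • v) (𝓝 0) (𝓝 P) := by
      simpa using hl.continuousAt.tendsto
    exact ht.eventually hrefl
  have hdec (u w χ : ℂ) : S' ((u, w), χ) =
      u * S' ((1, 0), 0) + w * S' ((0, 1), 0) + χ * S' ((0, 0), 1) := by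
    have : (((u, w), χ) : C2 × ℂ) = u • ((1, 0), 0) + w • ((0, 1), 0) + χ • ((0, 0), 1) := by
      simp
    rw [this, map_add, map_add, map_smul, map_smul, map_smul]
    simp only [smul_eq_mul]
  constructor
  · intro h0
    have := hconj ((0, 1), 0)
    rw [h0, hdec, h0] at this
    simp at this
  · have := hconj ((0, 0), 1)
    rw [hdec] at this
    simpa using congrArg (starRingEnd ℂ) this

theorem NoPeakAt.first_order {L : Set C2} {q : C2} (hL : NoPeakAt L q) (hqL : q ∈ L)
    {S : C2 × ℂ → ℂ} (hS : AnalyticAt ℂ S (q, (starRingEnd ℂ) q.1))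
    (hLS : ∀ᶠ x in 𝓝 q, x ∈ L → (starRingEnd ℂ) x.2 = S (x, (starRingEnd ℂ) x.1)) {a : ℂ}
    (ha₁ : fderiv ℂ S (q, (starRingEnd ℂ) q.1) ((1, a), 0) = 0)
    (ha₂ : fderiv ℂ S (q, (starRingEnd ℂ) q.1) ((0, 0), 1) = (starRingEnd ℂ) a) :
    fderiv ℂ (fderiv ℂ S) (q, (starRingEnd ℂ) q.1) ((1, a), 0) ((0, 0), 1) = 0 ∧
    ∀ H : C2 × ℂ → ℂ, AnalyticAt ℂ H (q, (starRingEnd ℂ) q.1) →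
      (∀ᶠ x in 𝓝 q, x ∈ L → H (x, (starRingEnd ℂ) x.1) = 0) →
      fderiv ℂ H (q, (starRingEnd ℂ) q.1) ((1, a), 0) = 0 ∧
        fderiv ℂ H (q, (starRingEnd ℂ) q.1) ((0, 0), 1) = 0 := by
  set b := fderiv ℂ (fderiv ℂ S) (q, (starRingEnd ℂ) q.1) ((1, a), 0) ((0, 0), 1) with hb
  set Sw := fderiv ℂ S (q, (starRingEnd ℂ) q.1) ((0, 1), 0) with hSw
  have hb0 : b = 0 := by
    by_contra hne
    have hpos : 0 < Complex.normSq b := Complex.normSq_pos.2 hne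
    have key (c : ℂ) (hμ : (starRingEnd ℂ) c - c * Sw ≠ 0) : 0 ≤ (c * b).re := by
      have := hL.levi_le hqL hS (analyticAt_const (v := 0)) hLS (by simp) ha₁ ha₂ c hμ
      simpa using this
    by_cases h : b = (starRingEnd ℂ) b * Sw
    · have := key (-(starRingEnd ℂ) b * (1 + I)) (by
        have e : (starRingEnd ℂ) (-(starRingEnd ℂ) b * (1 + I)) -
            -(starRingEnd ℂ) b * (1 + I) * Sw = 2 * I * b := by
          have : -(starRingEnd ℂ) b * (1 + I) * Sw = -(b * (1 + I)) := by
            conv_rhs => rw [h]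
            ring
          rw [this]; simp; ring
        rw [e]
        simp [hne])
      have e : (-(starRingEnd ℂ) b * (1 + I) * b).re = -Complex.normSq b := by
        simp [Complex.normSq_apply]; ring
      linarith
    · have := key (-(starRingEnd ℂ) b) (by
        simp only [map_neg, Complex.conj_conj]
        intro h'
        exact h (by linear_combination -h'))
      have e : (-(starRingEnd ℂ) b * b).re = -Complex.normSq b := by
        simp [Complex.normSq_apply]
      linarith
  refine ⟨hb0, fun H hH hLH => ?_⟩
  obtain ⟨c, hc⟩ : ∃ c : ℂ, (starRingEnd ℂ) c - c * Sw ≠ 0 := by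
    by_contra! h
    have h1 := h 1
    have h2 := h I
    simp only [map_one, one_mul, Complex.conj_I] at h1 h2
    have : (2 : ℂ) * I = 0 := by linear_combination I * h1 - h2
    simp at this
  have := hL.levi_le hqL hS hH hLS hLH ha₁ ha₂ c hc
  rw [← hb, hb0] at this
  simp only [mul_zero, zero_re, neg_zero, zero_add] at this
  constructor
  · rw [← norm_eq_zero, ← sq_eq_zero_iff]
    linarith [sq_nonneg ‖fderiv ℂ H (q, (starRingEnd ℂ) q.1) ((1, a), 0)‖,
      sq_nonneg ‖fderiv ℂ H (q, (starRingEnd ℂ) q.1) ((0, 0), 1)‖]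
  · rw [← norm_eq_zero, ← sq_eq_zero_iff]
    linarith [sq_nonneg ‖fderiv ℂ H (q, (starRingEnd ℂ) q.1) ((1, a), 0)‖,
      sq_nonneg ‖fderiv ℂ H (q, (starRingEnd ℂ) q.1) ((0, 0), 1)‖]

/-- Germs at `p` of analytic functions of `(z, w, z̄)` vanishing on `L`. -/
def VanishesOn (L : Set C2) (p : C2) (H : C2 × ℂ → ℂ) : Prop :=
  AnalyticAt ℂ H (p, (starRingEnd ℂ) p.1) ∧
    ∀ᶠ x in 𝓝 p, x ∈ L → H (x, (starRingEnd ℂ) x.1) = 0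

/-- The derivation `∂/∂z + a ∂/∂w`. -/
def derivTangent (a H : C2 × ℂ → ℂ) (y : C2 × ℂ) : ℂ := fderiv ℂ H y ((1, a y), 0)

/-- The derivation `∂/∂χ`. -/
def derivConj (H : C2 × ℂ → ℂ) (y : C2 × ℂ) : ℂ := fderiv ℂ H y ((0, 0), 1)

theorem analyticAt_clm_apply {E : Type*} [NormedAddCommGroup E] [NormedSpace ℂ E]
    {g : E → E →L[ℂ] ℂ} {v : E → E} {y : E} (hg : AnalyticAt ℂ g y) (hv : AnalyticAt ℂ v y) :
    AnalyticAt ℂ (fun y => g y (v y)) y :=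
  AnalyticAt.comp₂ (h := fun z : (E →L[ℂ] ℂ) × E => z.1 z.2)
    ((ContinuousLinearMap.id ℂ (E →L[ℂ] ℂ)).analyticAt_bilinear (g y, v y)) hg hv

theorem AnalyticAt.derivTangent {a H : C2 × ℂ → ℂ} {y : C2 × ℂ} (ha : AnalyticAt ℂ a y)
    (hH : AnalyticAt ℂ H y) : AnalyticAt ℂ (derivTangent a H) y :=
  analyticAt_clm_apply hH.fderiv ((analyticAt_const.prod ha).prod analyticAt_const)

theorem AnalyticAt.derivConj {H : C2 × ℂ → ℂ} {y : C2 × ℂ} (hH : AnalyticAt ℂ H y) :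
    AnalyticAt ℂ (derivConj H) y :=
  analyticAt_clm_apply hH.fderiv analyticAt_const

theorem tendsto_conj_graph (p : C2) :
    Tendsto (fun x : C2 => (x, (starRingEnd ℂ) x.1)) (𝓝 p) (𝓝 (p, (starRingEnd ℂ) p.1)) := by
  have : Continuous fun x : C2 => (x, (starRingEnd ℂ) x.1) := by fun_prop
  exact this.tendsto p

/-- The slope `-S_z / S_w` of the level sets of `S(·, ·, χ)`. -/
def segreSlope (S : C2 × ℂ → ℂ) (y : C2 × ℂ) : ℂ :=
  -fderiv ℂ S y ((1, 0), 0) / fderiv ℂ S y ((0, 1), 0)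

theorem AnalyticAt.segreSlope {S : C2 × ℂ → ℂ} {y : C2 × ℂ} (hS : AnalyticAt ℂ S y)
    (h : fderiv ℂ S y ((0, 1), 0) ≠ 0) : AnalyticAt ℂ (segreSlope S) y :=
  (analyticAt_clm_apply hS.fderiv analyticAt_const).neg.div (analyticAt_clm_apply hS.fderiv analyticAt_const) h

theorem fderiv_segreSlope {S : C2 × ℂ → ℂ} {y : C2 × ℂ} (h : fderiv ℂ S y ((0, 1), 0) ≠ 0) :
    fderiv ℂ S y ((1, segreSlope S y), 0) = 0 := by
  have : (((1, segreSlope S y), 0) : C2 × ℂ) = ((1, 0), 0) + segreSlope S y • ((0, 1), 0) := by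
    simp
  rw [this, map_add, map_smul, segreSlope, smul_eq_mul, div_mul_cancel₀ _ h, add_neg_cancel]

theorem sndDeriv_segreSlope {S : C2 × ℂ → ℂ} {y : C2 × ℂ} (hS : AnalyticAt ℂ S y)
    (h : fderiv ℂ S y ((0, 1), 0) ≠ 0) :
    fderiv ℂ (fderiv ℂ S) y ((1, segreSlope S y), 0) ((0, 0), 1) +
      derivConj (segreSlope S) y * fderiv ℂ S y ((0, 1), 0) = 0 := by
  have ha := hS.segreSlope h
  have hcont : ContinuousAt (fun y => fderiv ℂ S y ((0, 1), 0)) y :=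
    (analyticAt_clm_apply hS.fderiv analyticAt_const).continuousAt
  have hz : (fun y => fderiv ℂ S y ((1, segreSlope S y), 0)) =ᶠ[𝓝 y] fun _ => 0 := by
    filter_upwards [hcont.eventually_ne h] with x hx using fderiv_segreSlope hx
  have h1 : HasFDerivAt (fun y => (((1, segreSlope S y), 0) : C2 × ℂ))
      ((((0 : C2 × ℂ →L[ℂ] ℂ).prod (fderiv ℂ (segreSlope S) y))).prod 0) y :=
    ((hasFDerivAt_const _ _).prodMk ha.differentiableAt.hasFDerivAt).prodMk (hasFDerivAt_const _ _)
  have h2 := hS.fderiv.differentiableAt.hasFDerivAt.clm_apply h1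
  have h3 := h2.unique ((hasFDerivAt_const (0 : ℂ) y).congr_of_eventuallyEq hz)
  have h4 := DFunLike.congr_fun h3 ((0, 0), 1)
  have hsym : fderiv ℂ (fderiv ℂ S) y ((1, segreSlope S y), 0) ((0, 0), 1) =
      fderiv ℂ (fderiv ℂ S) y ((0, 0), 1) ((1, segreSlope S y), 0) := by
    have h1 : ContDiffAt ℂ ⊤ S y := hS.contDiffAt
    exact h1.isSymmSndFDerivAt (by simp) _ _
  have h5 : (((0, fderiv ℂ (segreSlope S) y ((0, 0), 1)), 0) : C2 × ℂ) =
      fderiv ℂ (segreSlope S) y ((0, 0), 1) • ((0, 1), 0) := by simp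
  simp only [_root_.add_apply, ContinuousLinearMap.comp_apply, ContinuousLinearMap.prod_apply,
    ContinuousLinearMap.flip_apply, _root_.zero_apply, h5, map_smul, smul_eq_mul] at h4
  rw [hsym, derivConj]
  linear_combination h4

theorem derivTangent_iterate_analyticAt {a H : C2 × ℂ → ℂ} {y : C2 × ℂ} (ha : AnalyticAt ℂ a y)
    (hH : AnalyticAt ℂ H y) (m : ℕ) : AnalyticAt ℂ ((derivTangent a)^[m] H) y := by
  induction m with
  | zero => exact hH
  | succ m ih => rw [Function.iterate_succ_apply']; exact ha.derivTangent ih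

theorem derivConj_iterate_analyticAt {H : C2 × ℂ → ℂ} {y : C2 × ℂ}
    (hH : AnalyticAt ℂ H y) (m : ℕ) : AnalyticAt ℂ (derivConj^[m] H) y := by
  induction m with
  | zero => exact hH
  | succ m ih => rw [Function.iterate_succ_apply']; exact ih.derivConj

section Ideal

variable {L : Set C2} {p : C2} {S : C2 × ℂ → ℂ}

theorem vanishesOn_segre (hS : AnalyticAt ℂ S (p, (starRingEnd ℂ) p.1))
    (hrefl : ∀ᶠ y in 𝓝 (p, (starRingEnd ℂ) p.1),
      (starRingEnd ℂ) (S (((starRingEnd ℂ) y.2, (starRingEnd ℂ) (S y)),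
        (starRingEnd ℂ) y.1.1)) = y.1.2)
    (hLS : ∀ᶠ x in 𝓝 p, x ∈ L → (starRingEnd ℂ) x.2 = S (x, (starRingEnd ℂ) x.1))
    (hpL : p ∈ L) (hL : ∀ᶠ q in 𝓝 p, q ∈ L → NoPeakAt L q) :
    VanishesOn L p (derivConj (segreSlope S)) ∧ ∀ H, VanishesOn L p H →
      VanishesOn L p (derivTangent (segreSlope S) H) ∧ VanishesOn L p (derivConj H) := by
  have hSw := (segre_fderiv hS.differentiableAt (hLS.self_of_nhds hpL) hrefl).1
  have ha := hS.segreSlope hSw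
  have hall : ∀ᶠ q in 𝓝 p, q ∈ L → derivConj (segreSlope S) (q, (starRingEnd ℂ) q.1) = 0 ∧
      ∀ H : C2 × ℂ → ℂ, AnalyticAt ℂ H (q, (starRingEnd ℂ) q.1) →
        (∀ᶠ x in 𝓝 q, x ∈ L → H (x, (starRingEnd ℂ) x.1) = 0) →
        derivTangent (segreSlope S) H (q, (starRingEnd ℂ) q.1) = 0 ∧
          derivConj H (q, (starRingEnd ℂ) q.1) = 0 := by
    filter_upwards [(tendsto_conj_graph p).eventually hS.eventually_analyticAt,
      (tendsto_conj_graph p).eventually hrefl.eventually_nhds, hLS.eventually_nhds, hL]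
      with q h1 h2 h3 h4 hq
    obtain ⟨hne, hfirst⟩ := segre_fderiv h1.differentiableAt (h3.self_of_nhds hq) h2
    have ha₁ := fderiv_segreSlope hne
    have ha₂ : fderiv ℂ S (q, (starRingEnd ℂ) q.1) ((0, 0), 1) =
        (starRingEnd ℂ) (segreSlope S (q, (starRingEnd ℂ) q.1)) := by
      rw [segreSlope, eq_neg_of_add_eq_zero_left hfirst, neg_neg, mul_div_cancel_right₀ _ hne,
        Complex.conj_conj]
    obtain ⟨hb, hH⟩ := (h4 hq).first_order hq h1 h3 ha₁ ha₂
    refine ⟨?_, hH⟩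
    have := sndDeriv_segreSlope h1 hne
    rw [hb, zero_add] at this
    exact (mul_eq_zero.1 this).resolve_right hne
  refine ⟨⟨ha.derivConj, hall.mono fun q hq hqL => (hq hqL).1⟩, fun H hH => ?_⟩
  have hev : ∀ᶠ q in 𝓝 p, q ∈ L → derivTangent (segreSlope S) H (q, (starRingEnd ℂ) q.1) = 0 ∧
          derivConj H (q, (starRingEnd ℂ) q.1) = 0 := by
    filter_upwards [hall, hH.2.eventually_nhds,
      (tendsto_conj_graph p).eventually hH.1.eventually_analyticAt] with q h1 h2 h3 hq
    exact (h1 hq).2 H h3 h2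
  exact ⟨⟨ha.derivTangent hH.1, hev.mono fun q hq hqL => (hq hqL).1⟩,
    ⟨hH.1.derivConj, hev.mono fun q hq hqL => (hq hqL).2⟩⟩

end Ideal

theorem iterate_mem {α : Type*} {C : α → Prop} {f : α → α} (h : ∀ x, C x → C (f x)) {x : α}
    (hx : C x) (n : ℕ) : C (f^[n] x) := by
  induction n with
  | zero => exact hx
  | succ n ih => rw [Function.iterate_succ_apply']; exact h _ ih

theorem hasDerivAt_comp_curve {H : C2 × ℂ → ℂ} {h : ℂ → ℂ} {z h' χ : ℂ}
    (hH : DifferentiableAt ℂ H ((z, h z), χ)) (hh : HasDerivAt h h' z) :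
    HasDerivAt (fun z => H ((z, h z), χ)) (fderiv ℂ H ((z, h z), χ) ((1, h'), 0)) z :=
  hH.hasFDerivAt.comp_hasDerivAt z
    (((hasDerivAt_id z).prodMk hh).prodMk (hasDerivAt_const z χ))

theorem hasDerivAt_comp_snd {H : C2 × ℂ → ℂ} {x : C2} {χ : ℂ}
    (hH : DifferentiableAt ℂ H (x, χ)) :
    HasDerivAt (fun χ => H (x, χ)) (derivConj H (x, χ)) χ :=
  hH.hasFDerivAt.comp_hasDerivAt χ ((hasDerivAt_const χ x).prodMk (hasDerivAt_id χ))

theorem eqOn_zero_of_deriv_chain {k : ℕ → ℂ → ℂ} {c : ℂ} {ε : ℝ} (hε : 0 < ε)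
    (hd : ∀ m, ∀ z ∈ ball c ε, HasDerivAt (k m) (k (m + 1) z) z) (hz : ∀ m, k m c = 0) :
    ∀ z ∈ ball c ε, k 0 z = 0 := by
  have hk : DifferentiableOn ℂ (k 0) (ball c ε) := fun z hz =>
    (hd 0 z hz).differentiableAt.differentiableWithinAt
  have han : AnalyticOnNhd ℂ (k 0) (ball c ε) := hk.analyticOnNhd isOpen_ball
  have hev := eventually_eq_zero_of_deriv_chain (han c (mem_ball_self hε))
    (fun m => by
      filter_upwards [isOpen_ball.mem_nhds (mem_ball_self hε)] with z hz using (hd m z hz).deriv) hz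
  exact han.eqOn_zero_of_preconnected_of_eventuallyEq_zero (convex_ball c ε).isPreconnected
    (mem_ball_self hε) hev

theorem exists_disc_of_noPeakAt {L : Set C2} {p : C2} {S : C2 × ℂ → ℂ}
    (hS : AnalyticAt ℂ S (p, (starRingEnd ℂ) p.1))
    (hrefl : ∀ᶠ y in 𝓝 (p, (starRingEnd ℂ) p.1),
      (starRingEnd ℂ) (S (((starRingEnd ℂ) y.2, (starRingEnd ℂ) (S y)),
        (starRingEnd ℂ) y.1.1)) = y.1.2)
    (hLS : ∀ᶠ x in 𝓝 p, x ∈ L → (starRingEnd ℂ) x.2 = S (x, (starRingEnd ℂ) x.1))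
    (hpL : p ∈ L) (hL : ∀ᶠ q in 𝓝 p, q ∈ L → NoPeakAt L q) :
    ∃ h : ℂ → ℂ, ∃ ε > 0, DifferentiableOn ℂ h (ball p.1 ε) ∧ h p.1 = p.2 ∧
      ∀ z ∈ ball p.1 ε, (starRingEnd ℂ) (h z) = S ((z, h z), (starRingEnd ℂ) z) := by
  obtain ⟨hstart, hclosed⟩ := vanishesOn_segre hS hrefl hLS hpL hL
  have hSp := hLS.self_of_nhds hpL
  have hSw := (segre_fderiv hS.differentiableAt hSp hrefl).1
  set a := segreSlope S with ha
  set h : ℂ → ℂ := fun z => (starRingEnd ℂ) (S (p, (starRingEnd ℂ) z)) with hh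
  have hhp : h p.1 = p.2 := by simp [hh, ← hSp]
  set χ₀ := (starRingEnd ℂ) p.1 with hχ₀
  have hc1 : Tendsto (fun z : ℂ => (p, (starRingEnd ℂ) z)) (𝓝 p.1) (𝓝 (p, χ₀)) := by
    have : Continuous fun z : ℂ => (p, (starRingEnd ℂ) z) := by fun_prop
    exact this.tendsto p.1
  have hhc : Tendsto h (𝓝 p.1) (𝓝 p.2) := by
    have h1 := (hS.continuousAt.tendsto).comp hc1
    have h2 := (Complex.continuous_conj.tendsto _).comp h1
    rw [← hSp, Complex.conj_conj] at h2
    exact h2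
  have hc2 : Tendsto (fun u : ℂ × ℂ => ((u.1, h u.1), u.2)) (𝓝 p.1 ×ˢ 𝓝 χ₀) (𝓝 (p, χ₀)) :=
    (tendsto_fst.prodMk_nhds (hhc.comp tendsto_fst)).prodMk_nhds tendsto_snd
  have hgood : ∀ᶠ y in 𝓝 (p, χ₀), AnalyticAt ℂ S y ∧ fderiv ℂ S y ((0, 1), 0) ≠ 0 :=
    hS.eventually_analyticAt.and
      ((analyticAt_clm_apply hS.fderiv analyticAt_const).continuousAt.eventually_ne hSw)
  have hSh : ∀ᶠ z in 𝓝 p.1, S ((z, h z), χ₀) = (starRingEnd ℂ) p.2 := by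
    filter_upwards [hc1.eventually hrefl] with z hz
    rw [← hz]
    simp [hh, hχ₀]
  have hev2 := hc2.eventually hgood
  rw [← nhds_prod_eq] at hev2
  obtain ⟨ε₁, hε₁, hb1⟩ := Metric.eventually_nhds_iff.1 hev2
  obtain ⟨ε₂, hε₂, hb2⟩ := Metric.eventually_nhds_iff.1
    (hSh.and (hc1.eventually hS.eventually_analyticAt))
  set ε := min ε₁ ε₂ with hεdef
  have hε : 0 < ε := lt_min hε₁ hε₂
  have hp1 : p.1 ∈ ball p.1 ε := mem_ball_self hε
  have hχ₀b : χ₀ ∈ ball χ₀ ε := mem_ball_self hε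
  have hSan {z χ : ℂ} (hz : z ∈ ball p.1 ε) (hχ : χ ∈ ball χ₀ ε) : AnalyticAt ℂ S ((z, h z), χ) ∧
      fderiv ℂ S ((z, h z), χ) ((0, 1), 0) ≠ 0 :=
    hb1 (y := (z, χ)) (by
      rw [Prod.dist_eq]
      exact max_lt (lt_of_lt_of_le hz (min_le_left _ _)) (lt_of_lt_of_le hχ (min_le_left _ _)))
  have hSc {z : ℂ} (hz : z ∈ ball p.1 ε) : S ((z, h z), χ₀) = (starRingEnd ℂ) p.2 :=
    (hb2 (lt_of_lt_of_le hz (min_le_right _ _))).1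
  have hhd {z : ℂ} (hz : z ∈ ball p.1 ε) : DifferentiableAt ℂ h z := by
    have h1 := (hb2 (lt_of_lt_of_le hz (min_le_right _ _))).2
    have h2 := (hasDerivAt_comp_snd h1.differentiableAt).conj_conj
    rw [Complex.conj_conj] at h2
    exact h2.differentiableAt
  have hslope {z χ w : ℂ} (hz : z ∈ ball p.1 ε) (hχ : χ ∈ ball χ₀ ε) :
      fderiv ℂ S ((z, h z), χ) ((1, w), 0) =
        (w - a ((z, h z), χ)) * fderiv ℂ S ((z, h z), χ) ((0, 1), 0) := by
    have h1 := fderiv_segreSlope (hSan hz hχ).2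
    have : (((1, w), 0) : C2 × ℂ) = ((1, segreSlope S ((z, h z), χ)), 0) +
        (w - segreSlope S ((z, h z), χ)) • ((0, 1), 0) := by simp
    rw [this, map_add, h1, map_smul, smul_eq_mul, zero_add]
  have hh' {z : ℂ} (hz : z ∈ ball p.1 ε) : HasDerivAt h (a ((z, h z), χ₀)) z := by
    have h1 := (hhd hz).hasDerivAt
    have h2 := hasDerivAt_comp_curve (hSan hz hχ₀b).1.differentiableAt h1
    have h3 : (fun z => S ((z, h z), χ₀)) =ᶠ[𝓝 z] fun _ => (starRingEnd ℂ) p.2 := by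
      filter_upwards [isOpen_ball.mem_nhds hz] with x hx using hSc hx
    have h4 := h2.unique ((hasDerivAt_const z _).congr_of_eventuallyEq h3)
    rw [hslope hz hχ₀b] at h4
    rw [← sub_eq_zero.1 ((mul_eq_zero.1 h4).resolve_right (hSan hz hχ₀b).2)]
    exact h1
  have haan {z χ : ℂ} (hz : z ∈ ball p.1 ε) (hχ : χ ∈ ball χ₀ ε) : AnalyticAt ℂ a ((z, h z), χ) :=
    (hSan hz hχ).1.segreSlope (hSan hz hχ).2
  have hflat (n : ℕ) : ∀ z ∈ ball p.1 ε, (derivConj^[n] (derivConj a)) ((z, h z), χ₀) = 0 := by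
    have hn := iterate_mem (fun H hH => (hclosed H hH).2) hstart n
    refine eqOn_zero_of_deriv_chain (k := fun m z =>
      ((derivTangent a)^[m] (derivConj^[n] (derivConj a))) ((z, h z), χ₀)) hε ?_ ?_
    · intro m z hz
      have := derivTangent_iterate_analyticAt (haan hz hχ₀b)
        (derivConj_iterate_analyticAt (haan hz hχ₀b).derivConj n) m
      rw [Function.iterate_succ_apply']
      exact hasDerivAt_comp_curve this.differentiableAt (hh' hz)
    · intro m
      have := (iterate_mem (fun H hH => (hclosed H hH).1) hn m).2.self_of_nhds hpL
      rw [hhp]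
      exact this
  have hconst {z χ : ℂ} (hz : z ∈ ball p.1 ε) (hχ : χ ∈ ball χ₀ ε) :
      a ((z, h z), χ) = a ((z, h z), χ₀) := by
    have hzero : ∀ χ ∈ ball χ₀ ε, derivConj a ((z, h z), χ) = 0 := by
      refine eqOn_zero_of_deriv_chain (k := fun m χ =>
        (derivConj^[m] (derivConj a)) ((z, h z), χ)) hε ?_ (fun m => hflat m z hz)
      intro m χ hχ
      rw [Function.iterate_succ_apply']
      exact hasDerivAt_comp_snd
        (derivConj_iterate_analyticAt (haan hz hχ).derivConj m).differentiableAt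
    have hd : ∀ χ ∈ ball χ₀ ε, HasDerivAt (fun χ => a ((z, h z), χ)) 0 χ := fun χ hχ => by
      have := hasDerivAt_comp_snd (haan hz hχ).differentiableAt
      rwa [hzero χ hχ] at this
    exact isOpen_ball.is_const_of_deriv_eq_zero (convex_ball χ₀ ε).isPreconnected
      (fun χ hχ => (hd χ hχ).differentiableAt.differentiableWithinAt)
      (fun χ hχ => (hd χ hχ).deriv) hχ hχ₀b
  refine ⟨h, ε, hε, fun z hz => (hhd hz).differentiableWithinAt, hhp, fun z hz => ?_⟩
  have hχ : (starRingEnd ℂ) z ∈ ball χ₀ ε := by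
    rw [mem_ball, hχ₀, Complex.dist_conj_conj]
    exact hz
  have hd : ∀ x ∈ ball p.1 ε, HasDerivAt (fun x => S ((x, h x), (starRingEnd ℂ) z)) 0 x := by
    intro x hx
    have := hasDerivAt_comp_curve (hSan hx hχ).1.differentiableAt (hh' hx)
    rwa [hslope hx hχ, hconst hx hχ, sub_self, zero_mul] at this
  have := isOpen_ball.is_const_of_deriv_eq_zero (convex_ball p.1 ε).isPreconnected
      (fun x hx => (hd x hx).differentiableAt.differentiableWithinAt)
      (fun x hx => (hd x hx).deriv) hz hp1
  rw [this, hhp]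
  simp [hh]

theorem ContainsNoComplexCurve.not_noPeakAt_of_fderiv_snd {M L : Set C2}
    (hM : ContainsNoComplexCurve M) {r : C2 → ℝ} {p : C2} (hr : AnalyticAt ℝ r p)
    (hMr : ∀ᶠ x in 𝓝 p, x ∈ M ↔ r x = 0) {w₀ : ℂ} (hw : fderiv ℝ r p (0, w₀) ≠ 0)
    (hpL : p ∈ L) (hLM : ∀ᶠ x in 𝓝 p, x ∈ L → x ∈ M) :
    ¬ ∀ᶠ q in 𝓝 p, q ∈ L → NoPeakAt L q := by
  intro hL
  have hrp : r p = 0 := hMr.self_of_nhds.1 (hLM.self_of_nhds hpL)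
  obtain ⟨S, hS, -, hMS, hrefl⟩ := exists_segre hr hrp hw
  obtain ⟨h, ε, hε, hhd, hhp, hh⟩ := exists_disc_of_noPeakAt hS hrefl
    (by filter_upwards [hLM, hMr, hMS] with x h₁ h₂ h₃ hx using h₃.1 (h₂.1 (h₁ hx))) hpL hL
  have hφd : DifferentiableOn ℂ (fun ζ : ℂ => ((p.1 + ζ, h (p.1 + ζ)) : C2)) (ball 0 ε) := by
    refine DifferentiableOn.prodMk (by fun_prop) (hhd.comp (by fun_prop) fun ζ hζ => ?_)
    simpa [mem_ball, dist_eq_norm] using hζ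
  have hφ0 : (fun ζ : ℂ => ((p.1 + ζ, h (p.1 + ζ)) : C2)) 0 = p := by
    simp [hhp]
  have hφc : ContinuousAt (fun ζ : ℂ => ((p.1 + ζ, h (p.1 + ζ)) : C2)) 0 :=
    (hφd.differentiableAt (ball_mem_nhds 0 hε)).continuousAt
  have hmem : ∀ᶠ ζ in 𝓝 (0 : ℂ), ((p.1 + ζ, h (p.1 + ζ)) : C2) ∈ M := by
    have h₁ := hφc.eventually (by rw [hφ0]; exact hMr.and hMS)
    filter_upwards [h₁, ball_mem_nhds (0 : ℂ) hε] with ζ hζ hζε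
    exact hζ.1.2 (hζ.2.2 (hh _ (by simpa [mem_ball, dist_eq_norm] using hζε)))
  obtain ⟨δ, hδ, hδM⟩ := Metric.eventually_nhds_iff_ball.1
    (hmem.and (ball_mem_nhds (0 : ℂ) hε))
  have hδ2 : ((δ / 2 : ℝ) : ℂ) ∈ ball (0 : ℂ) δ := by
    rw [mem_ball_zero_iff, Complex.norm_real, Real.norm_eq_abs, abs_of_pos (half_pos hδ)]
    exact half_lt_self hδ
  have := hM _ δ hδ (hφd.mono fun ζ hζ => (hδM ζ hζ).2) (fun ζ hζ => (hδM ζ hζ).1) _ hδ2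
  have h1 := congrArg Prod.fst this
  simp at h1
  exact hδ.ne' h1

theorem NoPeakAt.swap {L : Set C2} {q : C2} (hL : NoPeakAt L q) :
    NoPeakAt (Prod.swap ⁻¹' L) q.swap := by
  intro Φ hΦ hΦ0 α C δ hα hC hδ hneg
  refine hL (Φ.trans (Homeomorph.prodComm ℂ ℂ)) ?_ ?_ α C δ hα hC hδ hneg
  · exact hΦ.snd.prodMk hΦ.fst
  · simp [hΦ0]

theorem ContainsNoComplexCurve.swap {M : Set C2} (hM : ContainsNoComplexCurve M) :
    ContainsNoComplexCurve (Prod.swap ⁻¹' M) := by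
  intro φ ε hε hφ hφM ζ hζ
  exact Prod.swap_injective
    (hM (fun ζ => (φ ζ).swap) ε hε (hφ.snd.prodMk hφ.fst) hφM ζ hζ)

theorem ContainsNoComplexCurve.not_noPeakAt {M L : Set C2}
    (hM : ContainsNoComplexCurve M) {r : C2 → ℝ} {p : C2} (hr : AnalyticAt ℝ r p)
    (hMr : ∀ᶠ x in 𝓝 p, x ∈ M ↔ r x = 0) (hdr : fderiv ℝ r p ≠ 0)
    (hpL : p ∈ L) (hLM : ∀ᶠ x in 𝓝 p, x ∈ L → x ∈ M) :
    ¬ ∀ᶠ q in 𝓝 p, q ∈ L → NoPeakAt L q := by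
  intro hL
  by_cases hsnd : ∃ w₀ : ℂ, fderiv ℝ r p (0, w₀) ≠ 0
  · obtain ⟨w₀, hw⟩ := hsnd
    exact hM.not_noPeakAt_of_fderiv_snd hr hMr hw hpL hLM hL
  by_cases hfst : ∃ w₀ : ℂ, fderiv ℝ r p (w₀, 0) ≠ 0
  · obtain ⟨w₀, hw⟩ := hfst
    have htend : Tendsto Prod.swap (𝓝 p.swap) (𝓝 p) := continuous_swap.tendsto p.swap
    have hsw : HasFDerivAt (Prod.swap : C2 → C2)
        (ContinuousLinearEquiv.prodComm ℝ ℂ ℂ : C2 →L[ℝ] C2) p.swap :=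
      (ContinuousLinearEquiv.prodComm ℝ ℂ ℂ : C2 →L[ℝ] C2).hasFDerivAt
    have hsa : AnalyticAt ℝ (Prod.swap : C2 → C2) p.swap :=
      (ContinuousLinearEquiv.prodComm ℝ ℂ ℂ : C2 →L[ℝ] C2).analyticAt p.swap
    have hd : fderiv ℝ (r ∘ Prod.swap) p.swap (0, w₀) ≠ 0 := by
      have hrd : HasFDerivAt r (fderiv ℝ r p) p.swap.swap := hr.differentiableAt.hasFDerivAt
      rw [(hrd.comp p.swap hsw).fderiv]
      exact hw
    refine hM.swap.not_noPeakAt_of_fderiv_snd (L := Prod.swap ⁻¹' L) (p := p.swap)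
      (AnalyticAt.comp (g := r) hr hsa) (htend.eventually hMr) hd hpL (htend.eventually hLM) ?_
    filter_upwards [htend.eventually hL] with q hq hqL
    exact (hq hqL).swap
  · push Not at hsnd hfst
    refine hdr (ContinuousLinearMap.ext fun x => ?_)
    have : x = (x.1, 0) + (0, x.2) := by simp
    rw [this, map_add, hsnd, hfst]
    simp

/-- The points of `G` at which the fibre of `f` in `G` over `c` accumulates. -/
def fibreAccPts (f : C2 → C2) (G : Set C2) (c : C2) : Set C2 :=
  {x | x ∈ G ∧ f x = c ∧ AccPt x (𝓟 {y | y ∈ G ∧ f y = c})}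

theorem exists_fibreAccPts_of_not_discrete {f : C2 → C2} {G S : Set C2} (hSG : S ⊆ G)
    (h : ¬ HasDiscreteFibresOn f S) : ∃ a ∈ S, a ∈ fibreAccPts f G (f a) := by
  unfold HasDiscreteFibresOn at h
  push Not at h
  obtain ⟨a, haS, ha⟩ := h
  refine ⟨a, haS, hSG haS, rfl, ?_⟩
  rw [accPt_iff_nhds]
  intro W hW
  obtain ⟨W', hW'W, hW', haW'⟩ := _root_.mem_nhds_iff.1 hW
  obtain ⟨w, ⟨hwW, hwS⟩, hfw, hne⟩ := ha W' hW' haW'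
  exact ⟨w, ⟨hW'W hwW, hSG hwS, hfw⟩, hne⟩

theorem isCompact_fibreAccPts_inter {f : C2 → C2} {B D K : Set C2} (hD : IsOpen D)
    (hf : ContinuousOn f D) {c : C2}
    (hc : ∀ q ∈ B ∩ frontier D, c ∉ clusterPtSet f D q) (hKB : K ⊆ B) (hK : IsCompact K) :
    IsCompact (fibreAccPts f (B ∩ D) c ∩ K) := by
  refine hK.of_isClosed_subset ?_ inter_subset_right
  refine IsSeqClosed.isClosed fun x b hx hxb => ?_
  have hbK : b ∈ K := hK.isClosed.isSeqClosed (fun n => (hx n).2) hxb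
  have hbD : b ∈ D := by
    by_contra hbD
    have hbcl : b ∈ closure D :=
      mem_closure_of_tendsto hxb (Eventually.of_forall fun n => (hx n).1.1.2)
    refine hc b ⟨hKB hbK, hbcl, fun h => hbD (interior_subset h)⟩
      ⟨x, fun n => (hx n).1.1.2, ⟨b, rfl, hxb⟩, ?_⟩
    simp only [(hx _).1.2.1]
    exact tendsto_const_nhds
  refine ⟨⟨⟨hKB hbK, hbD⟩, ?_, ?_⟩, hbK⟩
  · refine tendsto_nhds_unique ((hf.continuousAt (hD.mem_nhds hbD)).tendsto.comp hxb) ?_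
    simp only [Function.comp_def, (hx _).1.2.1]
    exact tendsto_const_nhds
  · exact (isClosed_derivedSet {y | y ∈ B ∩ D ∧ f y = c}).isSeqClosed
      (fun n => (hx n).1.2.2) hxb

theorem exists_tendsto_of_mem_limsupSet {A : ℕ → Set C2} {b : C2} (hb : b ∈ limsupSet A) :
    ∃ (k : ℕ → ℕ) (x : ℕ → C2), Tendsto k atTop atTop ∧ (∀ n, x n ∈ A (k n)) ∧
      Tendsto x atTop (𝓝 b) := by
  have : ∀ n : ℕ, ∃ k ≥ n, (A k ∩ ball b (1 / (n + 1 : ℝ))).Nonempty := fun n =>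
    frequently_atTop.1 (hb _ (ball_mem_nhds b Nat.one_div_pos_of_nat)) n
  choose k hk x hx using this
  refine ⟨k, x, tendsto_atTop_mono hk tendsto_id, fun n => (hx n).1, ?_⟩
  rw [tendsto_iff_dist_tendsto_zero]
  exact squeeze_zero (fun _ => dist_nonneg) (fun n => (mem_ball.1 (hx n).2).le)
    tendsto_one_div_add_atTop_nhds_zero_nat

theorem limsupSet_fibreAccPts_subset_frontier {f : C2 → C2} {B D : Set C2} {p : C2}
    (hD : IsOpen D) (hf : ContinuousOn f D) {a : ℕ → C2} (haD : ∀ n, a n ∈ D)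
    (hap : Tendsto a atTop (𝓝 p)) (hcp : ∀ c ∈ f '' D, c ∉ clusterPtSet f D p) :
    limsupSet (fun n => fibreAccPts f (B ∩ D) (f (a n))) ⊆ frontier D := by
  intro b hb
  obtain ⟨k, x, hk, hx, hxb⟩ := exists_tendsto_of_mem_limsupSet hb
  refine ⟨mem_closure_of_tendsto hxb (Eventually.of_forall fun n => (hx n).1.2), fun hbi => ?_⟩
  have hbD := interior_subset hbi
  refine hcp (f b) ⟨b, hbD, rfl⟩ ⟨fun n => a (k n), fun n => haD _, ⟨p, rfl, hap.comp hk⟩, ?_⟩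
  have := (hf.continuousAt (hD.mem_nhds hbD)).tendsto.comp hxb
  simpa only [Function.comp_def, (hx _).2.1] using this

/-- Proposition 3.2. Let `D, D'` be domains in `ℂ²`, both possibly
unbounded, and `f : D → D'` a non-constant holomorphic mapping. Suppose `M ⊆ ∂D` is
an open, smooth real analytic hypersurface of finite type, and let `p ∈ M`. Let `U`
be a neighbourhood of `p` in `ℂ²` such that the cluster set of no point of `U ∩ M`
intersects `D'`. Then there exists a possibly smaller neighbourhood `V` of `p` such
that `f : V ∩ D → D'` has discrete fibres. -/
theorem statement4 (D D' M : Set C2) (f : C2 → C2) (p : C2) (U : Set C2)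
    (hD : IsDomain2 D) (hD' : IsDomain2 D')
    (hf : DifferentiableOn ℂ f D) (hmaps : MapsTo f D D')
    (hnc : ∃ z ∈ D, ∃ w ∈ D, f z ≠ f w)
    (hM : IsOpenBoundaryPiece M D) (hMft : IsFiniteTypeHypersurface M)
    (hpM : p ∈ M) (hUopen : IsOpen U) (hpU : p ∈ U)
    (hcl : ∀ q ∈ U ∩ M, clusterPtSet f D q ∩ D' = ∅) :
    ∃ V : Set C2, IsOpen V ∧ p ∈ V ∧ HasDiscreteFibresOn f (V ∩ D) := by
  by_contra hV
  push Not at hV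
  obtain ⟨-, O, hO, hMO⟩ := hM
  obtain ⟨U₀, r, hU₀, hpU₀, hr, hdr, hMr⟩ := hMft.1 p hpM
  have hpO : p ∈ O := by
    rw [hMO] at hpM
    exact hpM.2
  have hcl' : ∀ q ∈ U ∩ O ∩ frontier D, ∀ c ∈ f '' D, c ∉ clusterPtSet f D q := by
    rintro q ⟨⟨hqU, hqO⟩, hqD⟩ _ ⟨z, hz, rfl⟩ hc
    have := hcl q ⟨hqU, by rw [hMO]; exact ⟨hqD, hqO⟩⟩
    exact (this.le ⟨hc, hmaps hz⟩ : f z ∈ (∅ : Set C2))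
  set B := U ∩ O
  have hBo : IsOpen B := hUopen.inter hO
  have hpB : p ∈ B := ⟨hpU, hpO⟩
  have hpD : p ∈ frontier D := by
    rw [hMO] at hpM
    exact hpM.1
  have hex : ∀ n : ℕ, ∃ a ∈ B ∩ ball p (1 / (n + 1 : ℝ)) ∩ D,
      a ∈ fibreAccPts f (B ∩ D) (f a) := fun n =>
    exists_fibreAccPts_of_not_discrete (inter_subset_inter_left D inter_subset_left)
      (hV _ (hBo.inter isOpen_ball) ⟨hpB, mem_ball_self Nat.one_div_pos_of_nat⟩)
  choose a haB haA using hex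
  have hap : Tendsto a atTop (𝓝 p) := by
    rw [tendsto_iff_dist_tendsto_zero]
    exact squeeze_zero (fun _ => dist_nonneg) (fun n => (mem_ball.1 (haB n).1.2).le)
      tendsto_one_div_add_atTop_nhds_zero_nat
  have hpL : p ∈ limsupSet (fun n => fibreAccPts f (B ∩ D) (f (a n))) := fun W hW =>
    ((hap.eventually hW).mono fun n hn => (⟨a n, haA n, hn⟩ :
      (fibreAccPts f (B ∩ D) (f (a n)) ∩ W).Nonempty)).frequently
  refine hMft.2.not_noPeakAt (hr p hpU₀) ?_ (hdr p hpU₀) hpL ?_ ?_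
  · filter_upwards [hU₀.mem_nhds hpU₀] with x hx
    have := Set.ext_iff.1 hMr x
    simpa [hx] using this
  · filter_upwards [hO.mem_nhds hpO] with x hx hxL
    rw [hMO]
    exact ⟨limsupSet_fibreAccPts_subset_frontier hD.1 hf.continuousOn (fun n => (haB n).2) hap
      (hcl' p ⟨hpB, hpD⟩) hxL, hx⟩
  · filter_upwards [hBo.mem_nhds hpB] with q hq hqL
    intro Φ hΦ hΦ0 α C δ hα hC hδ hneg
    exact not_peak hBo (fun n K hKB hK => isCompact_fibreAccPts_inter hD.1 hf.continuousOn
        (fun q hq => hcl' q hq _ ⟨a n, (haB n).2, rfl⟩) hKB hK)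
      (fun n => hasHalfSpacePoints_accPt (hBo.inter hD.1) (hf.mono inter_subset_right) (f (a n)))
      hqL hq Φ hΦ hΦ0 hα hC hδ hneg
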